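/- arXiv:2010.10023 — 16 statements merged into one kernel-verified Lean document; each statement's English description precedes it below -/
import Mathlib

section
/- Let p be a prime, n a positive integer, and F : GF(p^n) → GF(p^n) the power function F(x) = x^d for a positive integer d. For any fixed c ∈ GF(p^n) with c ≠ 1, the c-differential uniformity of F equals the maximum of the set { _cΔ_F(1,b) : b ∈ GF(p^n) } ∪ { gcd(d, p^n − 1) }. -/
open scoped Classical

/-- The number of solutions `x` of `F(x+a) - c·F(x) = b`, denoted `_cΔ_F(a,b)`. -/
noncomputable def deltaCount {F : Type*} [Field F] [Finite F]
    (f : F → F) (c a b : F) : ℕ :=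
  Nat.card {x : F // f (x + a) - c * f x = b}

/-- The `c`-differential uniformity of `F`: the maximum of `_cΔ_F(a,b)` over all
`a, b`, where `a ≠ 0` is required when `c = 1`. -/
noncomputable def cDiffUniformity {F : Type*} [Field F] [Finite F]
    (f : F → F) (c : F) : ℕ :=
  letI : Fintype F := Fintype.ofFinite F
  ((Finset.univ ×ˢ Finset.univ).filter fun ab : F × F => c ≠ 1 ∨ ab.1 ≠ 0).sup
    fun ab => deltaCount f c ab.1 ab.2

theorem card_pow_eq_one_eq_gcd {F : Type*} [Field F] [Finite F] {d : ℕ} (hd : 0 < d) :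
    Nat.card {x : F // x ^ d = 1} = Nat.gcd d (Nat.card F - 1) := by
  have e : {x : F // x ^ d = 1} ≃ (powMonoidHom d : Fˣ →* Fˣ).ker :=
    { toFun := fun x => ⟨Units.ofPowEqOne x.1 d x.2 hd.ne', by
        rw [MonoidHom.mem_ker]
        ext
        simp⟩
      invFun := fun u => ⟨(u.1 : F), by
        have h := congrArg Units.val (MonoidHom.mem_ker.1 u.2)
        simpa using h⟩
      left_inv := fun x => by ext; simp
      right_inv := fun u => by ext; simp }
  rw [Nat.card_congr e, IsCyclic.card_powMonoidHom_ker, Nat.card_units, Nat.gcd_comm]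

theorem card_pow_eq_le_gcd {F : Type*} [Field F] [Finite F] {d : ℕ} (hd : 0 < d) (b : F) :
    Nat.card {x : F // x ^ d = b} ≤ Nat.gcd d (Nat.card F - 1) := by
  rcases eq_or_ne b 0 with rfl | hb
  · have : Subsingleton {x : F // x ^ d = 0} :=
      ⟨fun x y => Subtype.ext ((eq_zero_of_pow_eq_zero x.2).trans
        (eq_zero_of_pow_eq_zero y.2).symm)⟩
    exact (Finite.card_le_one_iff_subsingleton.2 this).trans (Nat.gcd_pos_of_pos_left _ hd)
  · rcases isEmpty_or_nonempty {x : F // x ^ d = b} with h | ⟨⟨y, hy⟩⟩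
    · simp
    · have hy0 : y ≠ 0 := by
        rintro rfl
        exact hb (by rw [← hy, zero_pow hd.ne'])
      rw [← card_pow_eq_one_eq_gcd hd]
      refine Nat.card_le_card_of_injective
        (fun x => ⟨x.1 / y, by rw [div_pow, x.2, hy, div_self hb]⟩) fun x z h => ?_
      exact Subtype.ext ((div_left_inj' hy0).1 (congrArg Subtype.val h))

theorem deltaCount_pow_zero {F : Type*} [Field F] [Finite F] (d : ℕ) {c : F} (hc : c ≠ 1)
    (b : F) :
    deltaCount (fun x : F => x ^ d) c 0 b = Nat.card {x : F // x ^ d = b / (1 - c)} := by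
  have h : 1 - c ≠ 0 := sub_ne_zero.2 hc.symm
  refine Nat.card_congr (Equiv.subtypeEquivRight fun x => ?_)
  rw [eq_div_iff h, add_zero]
  ring_nf

theorem deltaCount_pow_eq_one {F : Type*} [Field F] [Finite F] (d : ℕ) (c : F) {a : F}
    (ha : a ≠ 0) (b : F) :
    deltaCount (fun x : F => x ^ d) c a b =
      deltaCount (fun x : F => x ^ d) c 1 (b / a ^ d) := by
  refine (Nat.card_congr ((Equiv.mulLeft₀ a ha).subtypeEquiv fun x => ?_)).symm
  have h : (a * x + a) ^ d - c * (a * x) ^ d = ((x + 1) ^ d - c * x ^ d) * a ^ d := by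
    rw [← mul_add_one, mul_pow, mul_pow]
    ring
  rw [eq_div_iff (pow_ne_zero d ha), ← h]
  rfl

theorem stmt_0 (p n : ℕ) [Fact p.Prime] (hn : 0 < n) (d : ℕ) (hd : 0 < d)
    (c : GaloisField p n) (hc : c ≠ 1) :
    letI : Fintype (GaloisField p n) := Fintype.ofFinite _
    cDiffUniformity (fun x : GaloisField p n => x ^ d) c =
      max (Finset.univ.sup fun b : GaloisField p n =>
            deltaCount (fun x : GaloisField p n => x ^ d) c 1 b)
          (Nat.gcd d (p ^ n - 1)) := by
  have hcard := GaloisField.card p n hn.ne'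
  rw [← hcard]
  let : Fintype (GaloisField p n) := Fintype.ofFinite _
  unfold cDiffUniformity
  apply le_antisymm
  · refine Finset.sup_le fun ab _ => ?_
    rcases eq_or_ne ab.1 0 with h | h
    · rw [h, deltaCount_pow_zero d hc]
      exact le_max_of_le_right (card_pow_eq_le_gcd hd _)
    · rw [deltaCount_pow_eq_one d c h]
      exact le_max_of_le_left (Finset.le_sup
        (f := fun b => deltaCount (fun x : GaloisField p n => x ^ d) c 1 b) (Finset.mem_univ _))
  · have key (a b : GaloisField p n) := Finset.le_sup
      (s := (Finset.univ ×ˢ Finset.univ).filter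
        fun ab : GaloisField p n × GaloisField p n => c ≠ 1 ∨ ab.1 ≠ 0)
      (f := fun ab => deltaCount (fun x : GaloisField p n => x ^ d) c ab.1 ab.2)
      (b := (a, b)) (by simp [hc])
    refine max_le (Finset.sup_le fun b _ => key 1 b) ?_
    have h := key 0 (1 - c)
    rwa [deltaCount_pow_zero d hc, div_self (sub_ne_zero.2 hc.symm),
      card_pow_eq_one_eq_gcd hd] at h
end

section
/- Let k and n be positive integers with k ≤ n. Then gcd(2^k + 1, 2^n − 1) = (2^{gcd(2k,n)} − 1)/(2^{gcd(k,n)} − 1). -/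
theorem coprime_two_pow_add_one_two_pow_sub_one {k : ℕ} (hk : 0 < k) :
    Nat.Coprime (2 ^ k + 1) (2 ^ k - 1) := by
  have h1 : 1 ≤ 2 ^ k := Nat.one_le_two_pow
  have hodd : Odd (2 ^ k - 1) :=
    Nat.Even.sub_odd h1 ((Nat.even_pow).2 ⟨even_two, hk.ne'⟩) odd_one
  have h : 2 ^ k + 1 = 2 + (2 ^ k - 1) := by omega
  rw [h, Nat.coprime_add_self_left]
  exact hodd.coprime_two_left

theorem stmt_1 (k n : ℕ) (hk : 0 < k) (hkn : k ≤ n) :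
    Nat.gcd (2 ^ k + 1) (2 ^ n - 1) =
      (2 ^ Nat.gcd (2 * k) n - 1) / (2 ^ Nat.gcd k n - 1) := by
  have hfactor : 2 ^ (2 * k) - 1 = (2 ^ k + 1) * (2 ^ k - 1) := by
    rw [mul_comm 2 k, pow_mul, ← Nat.sq_sub_sq, one_pow]
  have hpos : 0 < 2 ^ Nat.gcd k n - 1 :=
    Nat.sub_pos_of_lt (Nat.one_lt_two_pow (Nat.gcd_pos_of_pos_left n hk).ne')
  symm
  apply Nat.div_eq_of_eq_mul_left hpos
  rw [← Nat.pow_sub_one_gcd_pow_sub_one, ← Nat.pow_sub_one_gcd_pow_sub_one, hfactor,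
    Nat.gcd_comm, (coprime_two_pow_add_one_two_pow_sub_one hk).gcd_mul,
    Nat.gcd_comm (2 ^ n - 1), Nat.gcd_comm (2 ^ n - 1)]
end

section
/- Let p be an odd prime and k, n positive integers with k ≤ n. If n/gcd(n,k) is odd, then gcd(p^k + 1, p^n − 1) = 2; if n/gcd(n,k) is even, then gcd(p^k + 1, p^n − 1) = p^{gcd(k,n)} + 1. -/
/-- A common divisor of `q ^ b + 1` and `q ^ a - 1` divides `q ^ gcd (2 * b) a - 1`. -/
theorem gcd_pow_add_one_pow_sub_one_dvd (q a b : ℕ) :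
    Nat.gcd (q ^ b + 1) (q ^ a - 1) ∣ q ^ Nat.gcd (2 * b) a - 1 := by
  rw [← Nat.pow_sub_one_gcd_pow_sub_one]
  refine Nat.gcd_dvd_gcd_of_dvd_left _ ⟨q ^ b - 1, ?_⟩
  rw [mul_comm 2 b, pow_mul, ← Nat.sq_sub_sq, one_pow]

theorem gcd_pow_add_one_pow_sub_one_of_odd {q a b : ℕ} (hq : Odd q) (hab : Nat.Coprime a b)
    (ha : Odd a) : Nat.gcd (q ^ b + 1) (q ^ a - 1) = 2 := by
  have h := gcd_pow_add_one_pow_sub_one_dvd q a b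
  have hc : Nat.gcd (2 * b) a = 1 :=
    Nat.Coprime.mul_left ha.coprime_two_left hab.symm
  rw [hc, pow_one] at h
  apply Nat.dvd_antisymm
  · have h2 : Nat.gcd (q ^ b + 1) (q ^ a - 1) ∣ q ^ b - 1 :=
      h.trans (by simpa using Nat.sub_dvd_pow_sub_pow q 1 b)
    have h3 := Nat.dvd_sub (Nat.gcd_dvd_left (q ^ b + 1) (q ^ a - 1)) h2
    have hpos : 0 < q ^ b := pow_pos hq.pos b
    rwa [show q ^ b + 1 - (q ^ b - 1) = 2 by omega] at h3
  · exact Nat.dvd_gcd (hq.pow.add_odd odd_one).two_dvd (hq.pow.tsub_odd odd_one).two_dvd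

theorem gcd_pow_add_one_pow_sub_one_of_even {q a b : ℕ} (hq : 0 < q) (hab : Nat.Coprime a b)
    (ha : Even a) : Nat.gcd (q ^ b + 1) (q ^ a - 1) = q + 1 := by
  have hb : Odd b := (hab.coprime_dvd_left ha.two_dvd).odd_of_left
  have h := gcd_pow_add_one_pow_sub_one_dvd q a b
  have hc : Nat.gcd (2 * b) a = 2 := by
    rw [Nat.Coprime.gcd_mul_right_cancel 2 hab.symm]
    exact Nat.gcd_eq_left ha.two_dvd
  rw [hc] at h
  apply Nat.dvd_antisymm
  · obtain ⟨m, rfl⟩ := hb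
    have h2 : Nat.gcd (q ^ (2 * m + 1) + 1) (q ^ a - 1) ∣ q ^ (2 * m) - 1 :=
      h.trans (by simpa [pow_mul] using Nat.sub_dvd_pow_sub_pow (q ^ 2) 1 m)
    refine (Nat.dvd_add_right (h2.mul_left q)).1 ?_
    convert Nat.gcd_dvd_left (q ^ (2 * m + 1) + 1) (q ^ a - 1) using 1
    obtain ⟨c, hc⟩ := Nat.exists_eq_add_of_le' (Nat.one_le_pow (2 * m) q hq)
    rw [pow_succ, hc, Nat.add_sub_cancel]
    ring
  · refine Nat.dvd_gcd (by simpa using hb.nat_add_dvd_pow_add_pow q 1) ?_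
    obtain ⟨m, rfl⟩ := ha.two_dvd
    refine Dvd.dvd.trans (b := q ^ 2 - 1) ⟨q - 1, ?_⟩ ?_
    · rw [← Nat.sq_sub_sq, one_pow]
    · simpa [pow_mul] using Nat.sub_dvd_pow_sub_pow (q ^ 2) 1 m

theorem stmt_2 (p k n : ℕ) (hp : p.Prime) (hodd : Odd p) (hk : 0 < k) (hkn : k ≤ n) :
    (Odd (n / Nat.gcd n k) → Nat.gcd (p ^ k + 1) (p ^ n - 1) = 2) ∧
    (Even (n / Nat.gcd n k) →
      Nat.gcd (p ^ k + 1) (p ^ n - 1) = p ^ Nat.gcd k n + 1) := by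
  have hab : Nat.Coprime (n / Nat.gcd n k) (k / Nat.gcd n k) :=
    Nat.coprime_div_gcd_div_gcd (Nat.gcd_pos_of_pos_right n hk)
  have hn : p ^ n = (p ^ Nat.gcd n k) ^ (n / Nat.gcd n k) := by
    rw [← pow_mul, Nat.mul_div_cancel' (Nat.gcd_dvd_left n k)]
  have hk' : p ^ k = (p ^ Nat.gcd n k) ^ (k / Nat.gcd n k) := by
    rw [← pow_mul, Nat.mul_div_cancel' (Nat.gcd_dvd_right n k)]
  rw [Nat.gcd_comm k n, hn, hk']
  exact ⟨gcd_pow_add_one_pow_sub_one_of_odd hodd.pow hab,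
    gcd_pow_add_one_pow_sub_one_of_even (pow_pos hp.pos _) hab⟩
end

section
/- Let 2 ≤ k < n, n ≥ 3, and let G : GF(2^n) → GF(2^n) be the Gold function G(x) = x^{2^k+1}. Write d = gcd(n,k) and n = m·d with m ≥ 3. If c ∈ GF(2^d) (viewed inside GF(2^n)) and c ≠ 1, then the c-differential uniformity of G equals (2^{gcd(2k,n)} − 1)/(2^{gcd(k,n)} − 1). -/
open scoped Classical

theorem gcd_two_pow_add_one_two_pow_sub_one (k n : ℕ) (hk : 0 < k) :
    Nat.gcd (2 ^ n - 1) (2 ^ k + 1) =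
      (2 ^ Nat.gcd (2 * k) n - 1) / (2 ^ Nat.gcd k n - 1) := by
  have hpow : 2 ≤ 2 ^ k := by
    simpa using Nat.pow_le_pow_right (n := 2) (by norm_num) (Nat.one_le_iff_ne_zero.mpr hk.ne')
  have hodd : ¬ 2 ∣ 2 ^ k - 1 := by
    have : 2 ∣ 2 ^ k := dvd_pow_self 2 hk.ne'
    omega
  have hcop : Nat.Coprime (2 ^ k - 1) (2 ^ k + 1) := by
    have h : 2 ^ k + 1 = 2 + (2 ^ k - 1) := by omega
    rw [h, Nat.coprime_add_self_right]
    exact ((Nat.Prime.coprime_iff_not_dvd Nat.prime_two).mpr hodd).symm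
  have hprod : 2 ^ (2 * k) - 1 = (2 ^ k - 1) * (2 ^ k + 1) := by
    rw [mul_comm 2 k, pow_mul, mul_comm (2 ^ k - 1)]
    simpa using Nat.sq_sub_sq (2 ^ k) 1
  have hgcd := Nat.Coprime.gcd_mul (2 ^ n - 1) hcop
  rw [← hprod, Nat.gcd_comm _ (2 ^ (2 * k) - 1), Nat.gcd_comm _ (2 ^ k - 1),
    Nat.pow_sub_one_gcd_pow_sub_one, Nat.pow_sub_one_gcd_pow_sub_one] at hgcd
  have hpos : 0 < 2 ^ Nat.gcd k n - 1 := by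
    have := Nat.one_lt_two_pow (Nat.gcd_pos_of_pos_left n hk).ne'
    omega
  rw [hgcd, Nat.mul_div_cancel_left _ hpos]

/-- The fibre of the power map over `1` in a finite field. -/
theorem FiniteField.card_pow_eq_one {F : Type*} [Field F] [Finite F] {N : ℕ} (hN : N ≠ 0) :
    Nat.card {x : F // x ^ N = 1} = Nat.gcd (Nat.card F - 1) N := by
  rw [← Nat.card_units F, ← IsCyclic.card_powMonoidHom_ker]
  refine Nat.card_congr
    ⟨fun x => ⟨Units.mk0 x.1 ?_, ?_⟩, fun u => ⟨(u.1 : F), ?_⟩, ?_, ?_⟩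
  · rintro h
    have := x.2
    rw [h, zero_pow hN] at this
    exact zero_ne_one this
  · rw [MonoidHom.mem_ker]
    ext
    simpa using x.2
  · have := u.2
    rw [MonoidHom.mem_ker, Units.ext_iff] at this
    simpa using this
  · intro x
    rfl
  · intro u
    ext
    rfl

theorem FiniteField.card_pow_eq_le {F : Type*} [Field F] [Finite F] {N : ℕ} (hN : N ≠ 0)
    (b : F) : Nat.card {x : F // x ^ N = b} ≤ Nat.card {x : F // x ^ N = 1} := by
  by_cases hb : b = 0
  · subst hb
    have : Subsingleton {x : F // x ^ N = 0} := ⟨fun x y => Subtype.ext <| by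
      rw [eq_zero_of_pow_eq_zero x.2, eq_zero_of_pow_eq_zero y.2]⟩
    have : Nonempty {x : F // x ^ N = 1} := ⟨⟨1, one_pow N⟩⟩
    exact (Finite.card_le_one_iff_subsingleton.mpr ‹_›).trans Nat.card_pos
  · rcases isEmpty_or_nonempty {x : F // x ^ N = b} with h | ⟨⟨z, hz⟩⟩
    · simp
    · have hz0 : z ≠ 0 := by
        rintro rfl
        exact hb (by rw [← hz, zero_pow hN])
      refine Nat.card_le_card_of_injective
        (fun x => ⟨x.1 / z, by rw [div_pow, x.2, hz, div_self hb]⟩) fun x y hxy => ?_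
      exact Subtype.ext ((div_left_inj' hz0).mp (congrArg Subtype.val hxy))

/-- Completing the power: a `c`-derivative of a Gold function, with `c` fixed by the corresponding
Frobenius, is a translate of a scalar multiple of the function, up to an additive constant. -/
theorem gold_cDerivative_eq {F : Type*} [Field F] [CharP F 2] (k : ℕ) {c : F} (hc : c ≠ 1)
    (hfix : c ^ 2 ^ k = c) (a x : F) :
    (x + a) ^ (2 ^ k + 1) - c * x ^ (2 ^ k + 1) =
      (1 - c) * (x + a / (1 - c)) ^ (2 ^ k + 1) +
        (a ^ (2 ^ k + 1) - a ^ (2 ^ k + 1) / (1 - c)) := by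
  have he : 1 - c ≠ 0 := sub_ne_zero.mpr hc.symm
  have hefix : (1 - c) ^ 2 ^ k = 1 - c := by
    rw [sub_pow_char_pow, one_pow, hfix]
  simp only [pow_succ _ (2 ^ k), add_pow_char_pow, div_pow, hefix]
  field_simp
  ring

theorem deltaCount_gold {F : Type*} [Field F] [Finite F] [CharP F 2] (k : ℕ) {c : F}
    (hc : c ≠ 1) (hfix : c ^ 2 ^ k = c) (a b : F) :
    deltaCount (fun x : F => x ^ (2 ^ k + 1)) c a b =
      Nat.card {x : F // x ^ (2 ^ k + 1) =
        (b - (a ^ (2 ^ k + 1) - a ^ (2 ^ k + 1) / (1 - c))) / (1 - c)} := by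
  have he : 1 - c ≠ 0 := sub_ne_zero.mpr hc.symm
  refine Nat.card_congr ((Equiv.addRight (a / (1 - c))).subtypeEquiv fun x => ?_)
  rw [gold_cDerivative_eq k hc hfix, Equiv.coe_addRight, eq_div_iff he, eq_sub_iff_add_eq,
    mul_comm (1 - c)]

theorem cDiffUniformity_gold {F : Type*} [Field F] [Finite F] [CharP F 2] (k : ℕ) {c : F}
    (hc : c ≠ 1) (hfix : c ^ 2 ^ k = c) :
    cDiffUniformity (fun x : F => x ^ (2 ^ k + 1)) c =
      Nat.gcd (Nat.card F - 1) (2 ^ k + 1) := by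
  have he : 1 - c ≠ 0 := sub_ne_zero.mpr hc.symm
  let : Fintype F := Fintype.ofFinite F
  rw [← FiniteField.card_pow_eq_one (Nat.succ_ne_zero _)]
  unfold cDiffUniformity
  refine le_antisymm (Finset.sup_le fun ab _ => ?_) ?_
  · rw [deltaCount_gold k hc hfix]
    exact FiniteField.card_pow_eq_le (Nat.succ_ne_zero _) _
  · have h := deltaCount_gold k hc hfix 0 (1 - c)
    simp only [zero_pow (Nat.succ_ne_zero (2 ^ k)), zero_div, sub_zero, div_self he] at h
    rw [← h]
    exact Finset.le_sup (f := fun ab : F × F =>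
      deltaCount (fun x : F => x ^ (2 ^ k + 1)) c ab.1 ab.2) (b := (0, 1 - c)) (by simp [hc])

theorem pow_pow_eq_self_of_dvd {M : Type*} [Monoid M] {x : M} {p d k : ℕ} (hdk : d ∣ k)
    (h : x ^ p ^ d = x) : x ^ p ^ k = x := by
  obtain ⟨m, rfl⟩ := hdk
  induction m with
  | zero => simp
  | succ m ih => rw [Nat.mul_succ, pow_add, pow_mul, ih, h]

theorem stmt_5 (n k : ℕ) (hk : 2 ≤ k) (hkn : k < n) (hn : 3 ≤ n)
    (hm : 3 ≤ n / Nat.gcd n k)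
    (c : GaloisField 2 n) (hc : c ≠ 1)
    (hsub : c ^ 2 ^ Nat.gcd n k = c) :
    cDiffUniformity (fun x : GaloisField 2 n => x ^ (2 ^ k + 1)) c =
      (2 ^ Nat.gcd (2 * k) n - 1) / (2 ^ Nat.gcd k n - 1) := by
  rw [cDiffUniformity_gold k hc (pow_pow_eq_self_of_dvd (Nat.gcd_dvd_right n k) hsub),
    GaloisField.card 2 n (by omega), gcd_two_pow_add_one_two_pow_sub_one k n (by omega)]
end

section
/- Let 2 ≤ k < n, n ≥ 3, and let G : GF(2^n) → GF(2^n) be the Gold function G(x) = x^{2^k+1}. Write d = gcd(n,k) and n = m·d, and assume m ≥ 3 when m is odd and m ≥ 4 when m is even. If c ∈ GF(2^n) \ GF(2^d), then the c-differential uniformity of G equals 2^d + 1. -/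
open scoped Classical

section GoldFunction

variable {K : Type*} [Field K]

/-- In a field with `x ^ 2 ^ n = x`, the fixed points of `x ↦ x ^ 2 ^ k` are those of
`x ↦ x ^ 2 ^ gcd n k`. -/
theorem pow_two_pow_eq_self_iff_gcd {n : ℕ} (hK : ∀ x : K, x ^ 2 ^ n = x) (k : ℕ) (x : K) :
    x ^ 2 ^ k = x ↔ x ^ 2 ^ Nat.gcd n k = x := by
  have key (j : ℕ) : Function.IsPeriodicPt (fun y : K => y ^ 2) j x ↔ x ^ 2 ^ j = x := by
    rw [Function.IsPeriodicPt, Function.IsFixedPt, pow_iterate]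
  rw [← key, ← key]
  exact ⟨fun h => ((key n).2 (hK x)).gcd h, fun h => h.trans_dvd (Nat.gcd_dvd_right n k)⟩

theorem ncard_pow_two_pow_eq_self_le {d : ℕ} (hd : d ≠ 0) :
    {x : K | x ^ 2 ^ d = x}.ncard ≤ 2 ^ d := by
  have h0 := FiniteField.X_pow_card_pow_sub_X_ne_zero K hd (p := 2) one_lt_two
  have hdeg := FiniteField.X_pow_card_pow_sub_X_natDegree_eq K hd (p := 2) one_lt_two
  set p : Polynomial K := Polynomial.X ^ 2 ^ d - Polynomial.X with hp
  have hset : {x : K | x ^ 2 ^ d = x} = (p.roots.toFinset : Set K) := by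
    ext x
    rw [Finset.mem_coe, Multiset.mem_toFinset, Polynomial.mem_roots h0]
    simp [hp, sub_eq_zero]
  rw [hset, Set.ncard_coe_finset, ← hdeg]
  exact (Multiset.toFinset_card_le _).trans p.card_roots'

variable [CharP K 2]

/-- The solutions of the `c`-differential equation of the Gold function other than a given
solution `x₀` correspond, via `x = x₀ + z⁻¹`, to the solutions of an affine linearized equation. -/
theorem gold_cDiff_add_inv_eq_iff (k : ℕ) (a c x₀ : K) {z : K} (hz : z ≠ 0) :
    (x₀ + z⁻¹ + a) ^ (2 ^ k + 1) - c * (x₀ + z⁻¹) ^ (2 ^ k + 1) =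
        (x₀ + a) ^ (2 ^ k + 1) - c * x₀ ^ (2 ^ k + 1) ↔
      (1 - c) + (x₀ + a - c * x₀) * z + ((x₀ + a) ^ 2 ^ k - c * x₀ ^ 2 ^ k) * z ^ 2 ^ k = 0 := by
  have hzq : z ^ 2 ^ k ≠ 0 := pow_ne_zero _ hz
  rw [← sub_eq_zero]
  simp only [pow_succ _ (2 ^ k), add_pow_char_pow, inv_pow]
  generalize z ^ 2 ^ k = w at *
  generalize x₀ ^ 2 ^ k = y
  generalize a ^ 2 ^ k = e
  have : (y + w⁻¹ + e) * (x₀ + z⁻¹ + a) - c * ((y + w⁻¹) * (x₀ + z⁻¹)) -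
      ((y + e) * (x₀ + a) - c * (y * x₀)) =
      (w * z)⁻¹ * (1 - c + (x₀ + a - c * x₀) * z + (y + e - c * y) * w) := by
    field_simp
    ring
  rw [this, mul_eq_zero, or_iff_right (inv_ne_zero (mul_ne_zero hzq hz))]

theorem gold_cDiff_ncard_le [Finite K] {n k : ℕ} (hK : ∀ x : K, x ^ 2 ^ n = x)
    (hd : Nat.gcd n k ≠ 0) {c : K} (hc : c ≠ 1) (a b : K) :
    {x : K | (x + a) ^ (2 ^ k + 1) - c * x ^ (2 ^ k + 1) = b}.ncard ≤ 2 ^ Nat.gcd n k + 1 := by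
  set S := {x : K | (x + a) ^ (2 ^ k + 1) - c * x ^ (2 ^ k + 1) = b} with hS
  rcases S.eq_empty_or_nonempty with h | ⟨x₀, h₀⟩
  · simp [h]
  suffices h : (S \ {x₀}).ncard ≤ 2 ^ Nat.gcd n k by
    rw [← Set.ncard_sdiff_singleton_add_one h₀]
    lia
  rcases le_or_gt (S \ {x₀}).ncard 1 with h | h
  · exact h.trans Nat.one_le_two_pow
  obtain ⟨x₁, h₁, x₂, h₂, h₁₂⟩ := (Set.one_lt_ncard).1 h
  set z : K → K := fun x => (x - x₀)⁻¹ with hz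
  have z_inj : Function.Injective z := inv_injective.comp sub_left_injective
  have hD₂ : z x₂ - z x₁ ≠ 0 := sub_ne_zero.2 (z_inj.ne h₁₂.symm)
  set P := x₀ + a - c * x₀
  set R := (x₀ + a) ^ 2 ^ k - c * x₀ ^ 2 ^ k
  have affine : ∀ x ∈ S \ {x₀}, (1 - c) + P * z x + R * z x ^ 2 ^ k = 0 := by
    rintro x ⟨hx, hne⟩
    have hzx : z x ≠ 0 := inv_ne_zero (sub_ne_zero.2 hne)
    refine (gold_cDiff_add_inv_eq_iff k a c x₀ hzx).1 ?_
    have : x₀ + (z x)⁻¹ = x := by simp [hz]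
    rw [this]
    exact hx.trans h₀.symm
  have linear : ∀ x ∈ S \ {x₀}, P * (z x - z x₁) + R * (z x - z x₁) ^ 2 ^ k = 0 := by
    intro x hx
    rw [sub_pow_char_pow]
    linear_combination affine x hx - affine x₁ h₁
  have hR : R ≠ 0 := by
    intro hR
    have hP : P = 0 := by simpa [hR, hD₂] using linear x₂ h₂
    have := affine x₁ h₁
    simp only [hP, hR, zero_mul, add_zero] at this
    exact hc (sub_eq_zero.1 this).symm
  refine (Set.ncard_le_ncard_of_injOn (fun x => (z x - z x₁) / (z x₂ - z x₁)) ?_ ?_).trans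
    (ncard_pow_two_pow_eq_self_le hd)
  · intro x hx
    refine (pow_two_pow_eq_self_iff_gcd hK k _).1 ?_
    rw [div_pow, div_eq_div_iff (pow_ne_zero _ hD₂) hD₂]
    refine mul_left_cancel₀ hR ?_
    linear_combination (z x₂ - z x₁) * linear x hx - (z x - z x₁) * linear x₂ h₂
  · intro x _ y _ hxy
    exact z_inj (sub_left_injective ((div_left_inj' hD₂).1 hxy))

theorem exists_gold_cDiff_ncard_ge [Finite K] {k d : ℕ} {c : K} (hc : c ^ 2 ^ k ≠ c)
    {T : Set K} (hT : ∀ t ∈ T, t ^ 2 ^ k = t) (hcard : T.ncard = 2 ^ d) :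
    ∃ a b : K, 2 ^ d + 1 ≤
      {x : K | (x + a) ^ (2 ^ k + 1) - c * x ^ (2 ^ k + 1) = b}.ncard := by
  have hc1 : 1 - c ≠ 0 := by
    rintro h
    apply hc
    rw [← sub_eq_zero.1 h, one_pow]
  have hcc : c ^ 2 ^ k - c ≠ 0 := sub_ne_zero.2 hc
  have hsurj : Function.Surjective fun x : K => x ^ 2 ^ k :=
    Finite.injective_iff_surjective.1 (iterateFrobenius_inj K 2 k)
  set p := (1 - c) / (c ^ 2 ^ k - c) with hp
  have hpc : p * (c ^ 2 ^ k - c) = 1 - c := div_mul_cancel₀ _ hcc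
  obtain ⟨x₀, hx₀⟩ := hsurj ((p - p ^ 2 ^ k) / (c ^ 2 ^ k - c))
  dsimp only at hx₀
  rw [eq_div_iff hcc] at hx₀
  have hR : (p + c * x₀) ^ 2 ^ k - c * x₀ ^ 2 ^ k = p := by
    rw [add_pow_char_pow, mul_pow]
    linear_combination hx₀
  have affine : ∀ t ∈ T, (1 - c) + p * (c + t) + p * (c + t) ^ 2 ^ k = 0 := by
    intro t ht
    rw [add_pow_char_pow, hT t ht]
    linear_combination hpc + (1 - c + p * (c + t)) * CharTwo.two_eq_zero (R := K)
  have hne : ∀ t ∈ T, c + t ≠ 0 := by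
    intro t ht h
    have := affine t ht
    rw [h, zero_pow (by positivity), mul_zero, add_zero, add_zero] at this
    exact hc1 this
  set a := p + c * x₀ - x₀ with ha
  refine ⟨a, (x₀ + a) ^ (2 ^ k + 1) - c * x₀ ^ (2 ^ k + 1), ?_⟩
  have hxa : x₀ + a = p + c * x₀ := by rw [ha]; ring
  have g_inj : Function.Injective fun t : K => x₀ + (c + t)⁻¹ :=
    (add_right_injective x₀).comp (inv_injective.comp (add_right_injective c))
  have hmem : x₀ ∉ (fun t : K => x₀ + (c + t)⁻¹) '' T := by
    rintro ⟨t, ht, h⟩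
    exact hne t ht (inv_eq_zero.1 (add_eq_left.1 h))
  rw [← hcard, ← Set.ncard_image_of_injective T g_inj, ← Set.ncard_insert_of_notMem hmem]
  refine Set.ncard_le_ncard ?_
  rintro x (rfl | ⟨t, ht, rfl⟩)
  · rfl
  · refine (gold_cDiff_add_inv_eq_iff k a c x₀ (hne t ht)).2 ?_
    rw [hxa, hR]
    linear_combination affine t ht

end GoldFunction

theorem exists_set_galoisField_pow_eq_self {n d : ℕ} (hn : n ≠ 0) (hdn : d ∣ n) :
    ∃ T : Set (GaloisField 2 n), (∀ t ∈ T, t ^ 2 ^ d = t) ∧ T.ncard = 2 ^ d := by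
  have hd : d ≠ 0 := ne_zero_of_dvd_ne_zero hn hdn
  have hdvd : Module.finrank (ZMod 2) (GaloisField 2 d) ∣
      Module.finrank (ZMod 2) (GaloisField 2 n) := by
    rwa [GaloisField.finrank 2 hd, GaloisField.finrank 2 hn]
  obtain ⟨φ⟩ := FiniteField.nonempty_algHom_of_finrank_dvd hdvd
  refine ⟨Set.range φ, ?_, ?_⟩
  · rintro _ ⟨s, rfl⟩
    have := Fintype.ofFinite (GaloisField 2 d)
    rw [← map_pow, ← GaloisField.card 2 d hd, Nat.card_eq_fintype_card, FiniteField.pow_card]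
  · have φ_inj : Function.Injective φ := φ.toRingHom.injective
    rw [← Set.image_univ, Set.ncard_image_of_injective _ φ_inj, Set.ncard_univ,
      GaloisField.card 2 d hd]

theorem stmt_6 (n k : ℕ) (hk : 2 ≤ k) (hkn : k < n) (hn : 3 ≤ n)
    (hmodd : Odd (n / Nat.gcd n k) → 3 ≤ n / Nat.gcd n k)
    (hmeven : Even (n / Nat.gcd n k) → 4 ≤ n / Nat.gcd n k)
    (c : GaloisField 2 n)
    (hsub : c ^ 2 ^ Nat.gcd n k ≠ c) :
    cDiffUniformity (fun x : GaloisField 2 n => x ^ (2 ^ k + 1)) c =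
      2 ^ Nat.gcd n k + 1 := by
  have hn0 : n ≠ 0 := by lia
  have hd0 : Nat.gcd n k ≠ 0 := Nat.gcd_ne_zero_left hn0
  have hK (x : GaloisField 2 n) : x ^ 2 ^ n = x := by
    have := Fintype.ofFinite (GaloisField 2 n)
    rw [← GaloisField.card 2 n hn0, Nat.card_eq_fintype_card, FiniteField.pow_card]
  have hc1 : c ≠ 1 := by
    rintro rfl
    exact hsub (one_pow _)
  apply le_antisymm
  · exact Finset.sup_le fun ab _ => gold_cDiff_ncard_le hK hd0 hc1 ab.1 ab.2
  · obtain ⟨T, hT, hcard⟩ := exists_set_galoisField_pow_eq_self hn0 (Nat.gcd_dvd_left n k)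
    obtain ⟨a, b, hab⟩ := exists_gold_cDiff_ncard_ge
      (mt (pow_two_pow_eq_self_iff_gcd hK k c).1 hsub)
      (fun t ht => (pow_two_pow_eq_self_iff_gcd hK k t).2 (hT t ht)) hcard
    refine hab.trans ?_
    let _ : Fintype (GaloisField 2 n) := Fintype.ofFinite _
    exact Finset.le_sup (f := fun ab : GaloisField 2 n × GaloisField 2 n =>
      deltaCount (fun x : GaloisField 2 n => x ^ (2 ^ k + 1)) c ab.1 ab.2) (b := (a, b))
      (by simp [hc1])
end

section
/- Let p be an odd prime, 1 ≤ k < n, n ≥ 3, and let F : GF(p^n) → GF(p^n) be the power function F(x) = x^{(p^k+1)/2}. Then F is PcN for c = −1 (i.e., its (−1)-differential uniformity equals 1) if and only if 2n/gcd(2n,k) is odd. -/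
open scoped Classical

theorem coprime_half_pow_succ_of_odd {p n k : ℕ} (hodd : Odd p) (hn : 0 < n)
    (h : Odd (2 * n / Nat.gcd (2 * n) k)) :
    Nat.Coprime ((p ^ k + 1) / 2) (p ^ (2 * n) - 1) := by
  have hp0 : 0 < p := hodd.pos
  have hpk : Odd (p ^ k) := hodd.pow
  have h2d : 2 * ((p ^ k + 1) / 2) = p ^ k + 1 := by
    obtain ⟨m, hm⟩ := hpk
    omega
  have hg0 : 0 < Nat.gcd (2 * n) k := Nat.gcd_pos_of_pos_left _ (by omega)
  obtain ⟨g, m, l, hg, hml, hm, hl⟩ := Nat.exists_coprime' (m := 2 * n) (n := k) hg0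
  rw [hm, hl, Nat.gcd_mul_right, hml.gcd_eq_one, one_mul, Nat.mul_div_cancel _ hg] at h
  refine Nat.Coprime.symm (Nat.coprime_of_dvd fun r hr hr1 hr2 => ?_)
  have := Fact.mk hr
  have hk1 : ((p : ZMod r)) ^ k = -1 := by
    have : ((p ^ k + 1 : ℕ) : ZMod r) = 0 := by
      rw [ZMod.natCast_eq_zero_iff]
      exact h2d ▸ hr2.mul_left 2
    push_cast at this
    exact eq_neg_of_add_eq_zero_left this
  have hn1 : ((p : ZMod r)) ^ (2 * n) = 1 := by
    have h1 := (ZMod.natCast_eq_zero_iff _ _).2 hr1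
    rw [Nat.cast_sub (Nat.one_le_pow _ _ hp0)] at h1
    push_cast at h1
    exact sub_eq_zero.1 h1
  have h2k : ((p : ZMod r)) ^ (2 * k) = 1 := by
    rw [mul_comm, pow_mul, hk1]; norm_num
  have hgcd : Nat.gcd (2 * n) (2 * k) = g := by
    have hc : Nat.Coprime m (2 * l) := (Nat.coprime_two_right.2 h).mul_right hml
    rw [hm, hl, ← mul_assoc, Nat.gcd_mul_right, hc.gcd_eq_one, one_mul]
  have hg1 : ((p : ZMod r)) ^ g = 1 := by
    rw [← hgcd]
    exact pow_gcd_eq_one.2 ⟨hn1, h2k⟩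
  have hneg : (-1 : ZMod r) = 1 := by
    rw [← hk1, hl, mul_comm, pow_mul, hg1, one_pow]
  have hr2' : r = 2 := by
    have h2 : ((2 : ℕ) : ZMod r) = 0 := by
      push_cast
      linear_combination -hneg
    rw [ZMod.natCast_eq_zero_iff] at h2
    exact (Nat.prime_dvd_prime_iff_eq hr Nat.prime_two).1 h2
  subst hr2'
  have hge : Even g := by
    have : Even (m * g) := hm ▸ even_two_mul n
    exact (Nat.even_mul.1 this).resolve_left (Nat.not_even_iff_odd.2 h)
  obtain ⟨s, hs⟩ : Even k := hl ▸ hge.mul_left l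
  obtain ⟨t, ht⟩ : Odd (p ^ s) := hodd.pow
  have hsq : p ^ k = 4 * (t * t + t) + 1 := by
    rw [hs, pow_add, ht]; ring
  omega

theorem odd_of_coprime_half_pow_succ {p n k : ℕ} (hp : 3 ≤ p) (hodd : Odd p) (hk : 0 < k)
    (h : Nat.Coprime ((p ^ k + 1) / 2) (p ^ (2 * n) - 1)) :
    Odd (2 * n / Nat.gcd (2 * n) k) := by
  have hg0 : 0 < Nat.gcd (2 * n) k := Nat.gcd_pos_of_pos_right _ hk
  obtain ⟨g, m, l, hg, hml, hm, hl⟩ := Nat.exists_coprime' (m := 2 * n) (n := k) hg0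
  rw [hm, hl, Nat.gcd_mul_right, hml.gcd_eq_one, one_mul, Nat.mul_div_cancel _ hg]
  by_contra hodd_m
  obtain ⟨m', hm'⟩ := Nat.not_odd_iff_even.1 hodd_m
  have hlodd : Odd l := by
    rw [← Nat.coprime_two_left]
    exact hml.coprime_dvd_left ⟨m', by omega⟩
  obtain ⟨e, he⟩ : Odd (p ^ g) := hodd.pow
  have hpg : p ≤ p ^ g := Nat.le_self_pow hg.ne' p
  have hdvd : p ^ g + 1 ∣ p ^ k + 1 := by
    have := hlodd.nat_add_dvd_pow_add_pow (p ^ g) 1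
    rwa [one_pow, ← pow_mul, mul_comm g l, ← hl] at this
  have hdvd' : p ^ g + 1 ∣ p ^ (2 * n) - 1 := by
    have h1 : (p ^ g) ^ 2 - 1 ∣ ((p ^ g) ^ 2) ^ m' - 1 := by
      simpa using Nat.sub_dvd_pow_sub_pow ((p ^ g) ^ 2) 1 m'
    have h2 : ((p ^ g) ^ 2) ^ m' = p ^ (2 * n) := by
      rw [hm, hm', ← pow_mul, ← pow_mul]; congr 1; ring
    rw [h2] at h1
    refine dvd_trans ?_ h1
    have := Nat.sq_sub_sq (p ^ g) 1
    rw [one_pow] at this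
    exact this ▸ dvd_mul_right _ _
  have hhalf : e + 1 ∣ (p ^ k + 1) / 2 := by
    obtain ⟨c, hc⟩ := hdvd
    refine ⟨c, ?_⟩
    rw [hc, he, show (2 * e + 1 + 1) * c = 2 * ((e + 1) * c) by ring]
    exact Nat.mul_div_cancel_left _ two_pos
  have hhalf' : e + 1 ∣ p ^ (2 * n) - 1 :=
    dvd_trans ⟨2, by rw [he]; ring⟩ hdvd'
  have := Nat.eq_one_of_dvd_coprimes h hhalf hhalf'
  omega

/-- The Dickson-type identity for the exponent `(p ^ k + 1) / 2`. -/
theorem add_one_pow_add_sub_one_pow_eq {L : Type*} [Field L] (p k d : ℕ) [Fact p.Prime]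
    [CharP L p] (hd : 2 * d = p ^ k + 1) {y z : L} (hz : z ≠ 0)
    (hyz : 2 * y = z + z⁻¹) :
    2 ^ d * ((y + 1) ^ d + (y - 1) ^ d) = 2 * (z ^ d + (z ^ d)⁻¹) := by
  have h1 : 2 * z * (y + 1) = (z + 1) ^ 2 := by
    linear_combination z * hyz + mul_inv_cancel₀ hz
  have h3 : 2 * z * (y - 1) = (z - 1) ^ 2 := by
    linear_combination z * hyz + mul_inv_cancel₀ hz
  have hzd : z ^ d ≠ 0 := pow_ne_zero _ hz
  have key : (2 * z) ^ d * ((y + 1) ^ d + (y - 1) ^ d) = 2 * ((z ^ d) ^ 2 + 1) := by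
    rw [mul_add, ← mul_pow, ← mul_pow, h1, h3, ← pow_mul, ← pow_mul, ← pow_mul, mul_comm d 2, hd,
      pow_succ (z + 1), pow_succ (z - 1), pow_succ z, add_pow_char_pow, sub_pow_char_pow, one_pow]
    ring
  rw [mul_pow] at key
  apply mul_left_cancel₀ hzd
  have : z ^ d * (z ^ d)⁻¹ = 1 := mul_inv_cancel₀ hzd
  linear_combination key - 2 * this

theorem eq_or_eq_inv_of_add_inv_eq {L : Type*} [Field L] {u v : L} (hu : u ≠ 0) (hv : v ≠ 0)
    (h : u + u⁻¹ = v + v⁻¹) : u = v ∨ u = v⁻¹ := by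
  have : (u - v) * (u - v⁻¹) = 0 := by
    linear_combination u * h - mul_inv_cancel₀ hu + mul_inv_cancel₀ hv
  rcases mul_eq_zero.1 this with h | h
  · exact Or.inl (sub_eq_zero.1 h)
  · exact Or.inr (sub_eq_zero.1 h)

theorem eq_of_pow_eq_pow_of_coprime {L : Type*} [Field L] {u v : L} {d N : ℕ} (hv : v ≠ 0)
    (hd : d.Coprime N) (h : u ^ d = v ^ d) (huN : u ^ N = 1) (hvN : v ^ N = 1) : u = v := by
  have h1 : (u / v) ^ d = 1 := by rw [div_pow, h, div_self (pow_ne_zero _ hv)]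
  have h2 : (u / v) ^ N = 1 := by rw [div_pow, huN, hvN, div_one]
  have h3 : (u / v) ^ Nat.gcd d N = 1 := pow_gcd_eq_one.2 ⟨h1, h2⟩
  rw [hd.gcd_eq_one, pow_one] at h3
  exact (div_eq_one_iff_eq hv).1 h3

theorem pow_sq_sub_one_eq_one {G : Type*} [Group G] {z : G} {q : ℕ} (h : z ^ q = z ∨ z ^ q = z⁻¹)
    (hq : 0 < q) : z ^ (q ^ 2 - 1) = 1 := by
  have h1 : z ^ (q ^ 2) = z := by
    rw [sq, pow_mul]
    rcases h with h | h
    · rw [h, h]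
    · rw [h, inv_pow, h, inv_inv]
  have h2 : z ^ (q ^ 2 - 1) * z = z := by
    rw [← pow_succ, Nat.sub_add_cancel (Nat.one_le_pow _ _ hq), h1]
  exact mul_eq_right.1 h2

/-- Every element of a finite field of order `q` has the form `(z + z⁻¹) / 2` for some
`(q ^ 2 - 1)`-th root of unity `z` of the algebraic closure. -/
theorem exists_add_inv_eq {F : Type*} [Field F] [Fintype F] (y : F) :
    ∃ z : AlgebraicClosure F, z ≠ 0 ∧
      2 * algebraMap F (AlgebraicClosure F) y = z + z⁻¹ ∧ z ^ (Fintype.card F ^ 2 - 1) = 1 := by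
  set L := AlgebraicClosure F
  set w := algebraMap F L y
  obtain ⟨z, hz⟩ := IsAlgClosed.exists_root
    (Polynomial.X ^ 2 - Polynomial.C (2 * w) * Polynomial.X + 1 : Polynomial L)
    (by
      have : (Polynomial.X ^ 2 - Polynomial.C (2 * w) * Polynomial.X + 1 : Polynomial L).degree
          = 2 := by compute_degree!
      rw [this]; norm_num)
  simp only [Polynomial.IsRoot.def, Polynomial.eval_add, Polynomial.eval_sub, Polynomial.eval_pow,
    Polynomial.eval_X, Polynomial.eval_mul, Polynomial.eval_C, Polynomial.eval_one] at hz
  have hz0 : z ≠ 0 := by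
    rintro rfl
    simp at hz
  have hzw : 2 * w = z + z⁻¹ := by
    apply mul_left_cancel₀ hz0
    linear_combination -hz - mul_inv_cancel₀ hz0
  refine ⟨z, hz0, hzw, ?_⟩
  have hfrob : z ^ Fintype.card F + (z ^ Fintype.card F)⁻¹ = z + z⁻¹ := by
    have h1 : FiniteField.frobeniusAlgHom F L (2 * w) = 2 * w := by
      rw [map_mul, AlgHom.commutes, map_ofNat]
    rw [hzw] at h1
    rw [map_add, map_inv₀] at h1
    simpa only [FiniteField.coe_frobeniusAlgHom] using h1
  have hcases := eq_or_eq_inv_of_add_inv_eq (pow_ne_zero _ hz0) hz0 hfrob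
  have := pow_sq_sub_one_eq_one (z := Units.mk0 z hz0) (q := Fintype.card F)
    (by simpa [Units.ext_iff] using hcases) Fintype.card_pos
  simpa [Units.ext_iff] using this

theorem injective_pow_add_pow {F : Type*} [Field F] [Fintype F] (p k d : ℕ) [Fact p.Prime]
    [CharP F p] (h2 : (2 : F) ≠ 0) (hd : 2 * d = p ^ k + 1)
    (hcop : d.Coprime (Fintype.card F ^ 2 - 1)) (a : F) :
    Function.Injective fun x : F => (x + a) ^ d + x ^ d := by
  have hd0 : d ≠ 0 := by omega
  intro x₁ x₂ h
  simp only at h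
  rcases eq_or_ne a 0 with rfl | ha
  · have hx : x₁ ^ d = x₂ ^ d := by
      apply mul_left_cancel₀ h2
      rw [add_zero, add_zero] at h
      linear_combination h
    have hdvd : Fintype.card F - 1 ∣ Fintype.card F ^ 2 - 1 := by
      simpa using Nat.sub_dvd_pow_sub_pow (Fintype.card F) 1 2
    rcases eq_or_ne x₂ 0 with rfl | hx₂
    · rw [zero_pow hd0] at hx
      exact eq_zero_of_pow_eq_zero hx
    have hx₁ : x₁ ≠ 0 := by
      rintro rfl
      rw [zero_pow hd0] at hx
      exact hx₂ (eq_zero_of_pow_eq_zero hx.symm)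
    exact eq_of_pow_eq_pow_of_coprime hx₂ (hcop.coprime_dvd_right hdvd) hx
      (FiniteField.pow_card_sub_one_eq_one _ hx₁) (FiniteField.pow_card_sub_one_eq_one _ hx₂)
  have : CharP (AlgebraicClosure F) p := charP_of_injective_algebraMap
    (algebraMap F (AlgebraicClosure F)).injective p
  have h2L : (2 : AlgebraicClosure F) ≠ 0 := by
    rw [← map_ofNat (algebraMap F (AlgebraicClosure F)) 2]
    exact (map_ne_zero _).2 h2
  have hsub : ∀ x : F, ∃ y : F, x = a / 2 * (y - 1) ∧ x + a = a / 2 * (y + 1) := fun x =>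
    ⟨2 * x / a + 1, by field_simp; ring, by field_simp; ring⟩
  obtain ⟨y₁, hy₁, hy₁'⟩ := hsub x₁
  obtain ⟨y₂, hy₂, hy₂'⟩ := hsub x₂
  have hG : (y₁ + 1) ^ d + (y₁ - 1) ^ d = (y₂ + 1) ^ d + (y₂ - 1) ^ d := by
    rw [hy₁', hy₂', hy₁, hy₂, mul_pow, mul_pow, mul_pow, mul_pow] at h
    apply mul_left_cancel₀ (pow_ne_zero d (div_ne_zero ha h2))
    linear_combination h
  obtain ⟨z₁, hz₁, hyz₁, hN₁⟩ := exists_add_inv_eq y₁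
  obtain ⟨z₂, hz₂, hyz₂, hN₂⟩ := exists_add_inv_eq y₂
  have hGL := congrArg (algebraMap F (AlgebraicClosure F)) hG
  simp only [map_add, map_sub, map_pow, map_one] at hGL
  have hD := add_one_pow_add_sub_one_pow_eq p k d hd hz₁ hyz₁
  rw [hGL, add_one_pow_add_sub_one_pow_eq p k d hd hz₂ hyz₂] at hD
  have hz : z₁ + z₁⁻¹ = z₂ + z₂⁻¹ := by
    rcases eq_or_eq_inv_of_add_inv_eq (pow_ne_zero d hz₁) (pow_ne_zero d hz₂)
      (mul_left_cancel₀ h2L hD.symm) with h | h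
    · rw [eq_of_pow_eq_pow_of_coprime hz₂ hcop h hN₁ hN₂]
    · rw [← inv_pow] at h
      rw [eq_of_pow_eq_pow_of_coprime (inv_ne_zero hz₂) hcop h hN₁ (by rw [inv_pow, hN₂, inv_one]),
        inv_inv, add_comm]
  rw [← hyz₁, ← hyz₂] at hz
  have hy : y₁ = y₂ := (algebraMap F (AlgebraicClosure F)).injective (mul_left_cancel₀ h2L hz)
  rw [hy₁, hy₂, hy]

theorem coprime_of_injective_pow_add_pow {F : Type*} [Field F] [Fintype F] (p k d : ℕ)
    [Fact p.Prime] [CharP F p] (h2 : (2 : F) ≠ 0) (hk : 0 < k) (hd : 2 * d = p ^ k + 1)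
    (hinj : Function.Injective fun x : F => (x + 2) ^ d + x ^ d) :
    d.Coprime (Fintype.card F ^ 2 - 1) := by
  refine (Nat.coprime_of_dvd fun r hr hrd hrN => ?_)
  set L := AlgebraicClosure F
  have : CharP L p := charP_of_injective_algebraMap (algebraMap F L).injective p
  have h2L : (2 : L) ≠ 0 := by
    rw [← map_ofNat (algebraMap F L) 2]
    exact (map_ne_zero _).2 h2
  have : NeZero (r : L) := by
    refine ⟨fun h => ?_⟩
    have hpr : p ∣ r := (CharP.cast_eq_zero_iff L p r).1 h
    have h1 : p ∣ p ^ k + 1 := hd ▸ (hpr.trans hrd).mul_left 2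
    have h3 : p ∣ 1 := (Nat.dvd_add_right (dvd_pow_self p hk.ne')).1 h1
    exact (Fact.out : p.Prime).one_lt.ne' (Nat.dvd_one.1 h3)
  have : NeZero r := ⟨hr.ne_zero⟩
  obtain ⟨z, hzr⟩ := HasEnoughRootsOfUnity.exists_primitiveRoot L r
  have hz0 : z ≠ 0 := hzr.ne_zero hr.ne_zero
  have hz1 : z ≠ 1 := hzr.ne_one hr.one_lt
  have hzd : z ^ d = 1 := (hzr.pow_eq_one_iff_dvd d).2 hrd
  have hfix : (z + z⁻¹) ^ Fintype.card F = z + z⁻¹ := by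
    have hsum : (z + z⁻¹) ^ Fintype.card F = z ^ Fintype.card F + (z ^ Fintype.card F)⁻¹ := by
      have := map_add (FiniteField.frobeniusAlgHom F L) z z⁻¹
      rw [map_inv₀] at this
      simpa only [FiniteField.coe_frobeniusAlgHom] using this
    rw [hsum]
    have hfac : Fintype.card F ^ 2 - 1 = (Fintype.card F + 1) * (Fintype.card F - 1) := by
      simpa using Nat.sq_sub_sq (Fintype.card F) 1
    rw [hfac] at hrN
    rcases hr.dvd_mul.1 hrN with h | h
    · have h' := (hzr.pow_eq_one_iff_dvd _).2 h
      rw [pow_succ] at h'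
      rw [eq_inv_of_mul_eq_one_left h', inv_inv, add_comm]
    · have h' := (hzr.pow_eq_one_iff_dvd _).2 h
      have : z ^ Fintype.card F = z := by
        rw [← Nat.sub_add_cancel (Fintype.card_pos (α := F)), pow_succ, h', one_mul]
      rw [this]
  obtain ⟨s, hs⟩ : ∃ s : F, algebraMap F L s = z + z⁻¹ := by
    have hroot : ((Polynomial.X ^ Fintype.card F - Polynomial.X : Polynomial F).map
        (algebraMap F L)).IsRoot (z + z⁻¹) := by
      simp [hfix]
    have hsplits : (Polynomial.X ^ Fintype.card F - Polynomial.X : Polynomial F).Splits := by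
      rw [Polynomial.splits_iff_card_roots, FiniteField.roots_X_pow_card_sub_X,
        FiniteField.X_pow_card_sub_X_natDegree_eq F Fintype.one_lt_card]
      rfl
    exact hsplits.mem_range_of_isRoot
      (FiniteField.X_pow_card_sub_X_ne_zero F Fintype.one_lt_card) hroot
  have hy : 2 * algebraMap F L (s / 2) = z + z⁻¹ := by
    rw [← hs, map_div₀, map_ofNat, mul_div_cancel₀ _ h2L]
  have hD := add_one_pow_add_sub_one_pow_eq p k d hd hz0 hy
  have hD1 := add_one_pow_add_sub_one_pow_eq (y := (1 : L)) p k d hd one_ne_zero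
    (by norm_num)
  rw [one_pow] at hD1
  rw [hzd, ← hD1] at hD
  have hG : (s / 2 + 1) ^ d + (s / 2 - 1) ^ d = (1 + 1 : F) ^ d + (1 - 1) ^ d := by
    apply (algebraMap F L).injective
    simpa only [map_add, map_sub, map_pow, map_one] using
      mul_left_cancel₀ (pow_ne_zero d h2L) hD
  have heq : s / 2 - 1 = 1 - 1 := by
    apply hinj
    simp only
    rw [show s / 2 - 1 + 2 = s / 2 + 1 by ring, show (1 - 1 + 2 : F) = 1 + 1 by ring]
    exact hG
  have hs2 : s = 2 := by
    have : s / 2 = 1 := by linear_combination heq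
    exact (div_eq_one_iff_eq h2).1 this
  rw [hs2, map_ofNat] at hs
  have : (z - 1) ^ 2 = 0 := by
    linear_combination -z * hs - mul_inv_cancel₀ hz0
  exact hz1 (sub_eq_zero.1 (eq_zero_of_pow_eq_zero this))

theorem cDiffUniformity_eq_one_iff {F : Type*} [Field F] [Finite F] (f : F → F) {c : F}
    (hc : c ≠ 1) :
    cDiffUniformity f c = 1 ↔ ∀ a, Function.Injective fun x => f (x + a) - c * f x := by
  have hle : (∀ a, Function.Injective fun x => f (x + a) - c * f x) ↔
      cDiffUniformity f c ≤ 1 := by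
    simp only [cDiffUniformity, Finset.sup_le_iff, Finset.mem_filter, Finset.mem_product,
      Finset.mem_univ, true_and, Prod.forall, deltaCount, Finite.card_le_one_iff_subsingleton,
      hc, ne_eq, not_false_eq_true, true_or, forall_const]
    constructor
    · exact fun h a b => ⟨fun x y => Subtype.ext (h a (x.2.trans y.2.symm))⟩
    · intro h a x y hxy
      exact congrArg Subtype.val (@Subsingleton.elim _ (h a _) ⟨x, hxy⟩ ⟨y, rfl⟩)
  have hpos : 1 ≤ cDiffUniformity f c := by
    let : Fintype F := Fintype.ofFinite F
    have hcount : 1 ≤ deltaCount f c 0 (f (0 + 0) - c * f 0) := by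
      have : Nonempty {x : F // f (x + 0) - c * f x = f (0 + 0) - c * f 0} := ⟨⟨0, rfl⟩⟩
      exact Nat.card_pos
    refine hcount.trans ?_
    exact Finset.le_sup (f := fun ab : F × F => deltaCount f c ab.1 ab.2)
      (b := (0, f (0 + 0) - c * f 0)) (by simp [hc])
  rw [hle]
  omega

theorem stmt_7 (p n k : ℕ) [Fact p.Prime] (hodd : Odd p) (hk : 1 ≤ k) (hkn : k < n)
    (hn : 3 ≤ n) :
    cDiffUniformity
        (fun x : GaloisField p n => x ^ ((p ^ k + 1) / 2)) (-1 : GaloisField p n) = 1 ↔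
      Odd (2 * n / Nat.gcd (2 * n) k) := by
  let : Fintype (GaloisField p n) := Fintype.ofFinite _
  have hp2 : p ≠ 2 := by
    rintro rfl
    exact absurd hodd (by decide)
  have hp3 : 3 ≤ p := by
    have := (Fact.out : p.Prime).two_le
    omega
  have h2 : (2 : GaloisField p n) ≠ 0 :=
    Ring.two_ne_zero (by rwa [ringChar.eq (GaloisField p n) p])
  have hd : 2 * ((p ^ k + 1) / 2) = p ^ k + 1 := by
    obtain ⟨m, hm⟩ : Odd (p ^ k) := hodd.pow
    omega
  have hcard : Fintype.card (GaloisField p n) ^ 2 - 1 = p ^ (2 * n) - 1 := by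
    rw [← Nat.card_eq_fintype_card, GaloisField.card p n (by omega), ← pow_mul, mul_comm]
  have hc : (-1 : GaloisField p n) ≠ 1 := fun h => h2 (by linear_combination -h)
  rw [cDiffUniformity_eq_one_iff _ hc]
  simp only [neg_one_mul, sub_neg_eq_add]
  constructor
  · intro h
    have := coprime_of_injective_pow_add_pow p k _ h2 hk hd (h 2)
    rw [hcard] at this
    exact odd_of_coprime_half_pow_succ hp3 hodd hk this
  · intro h
    have := coprime_half_pow_succ_of_odd hodd (by omega) h
    rw [← hcard] at this
    exact injective_pow_add_pow p k _ h2 hd this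
end

section
/- Let p be an odd prime, 1 ≤ k < n, n ≥ 3, and let F : GF(p^n) → GF(p^n) be the power function F(x) = x^{(p^k+1)/2}. If 2n/gcd(2n,k) is even, then the (−1)-differential uniformity of F equals (p^{gcd(k,n)} + 1)/2. -/
open scoped Classical

/-- Elements of a field with prescribed `N`-th power `1` and prescribed `d`-th power number at most
`gcd d N`. -/
lemma card_le_gcd_of_pow_eq {L : Type*} [Field L] (T : Finset L) {N d : ℕ} (hN : 0 < N) (u : L)
    (hT : ∀ y ∈ T, y ^ N = 1 ∧ y ^ d = u) : T.card ≤ Nat.gcd d N := by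
  rcases T.eq_empty_or_nonempty with rfl | ⟨y₀, hy₀⟩
  · simp
  have hne : ∀ y ∈ T, y ≠ 0 := by
    rintro y hy rfl
    have := (hT 0 hy).1
    rw [zero_pow hN.ne'] at this
    exact zero_ne_one this
  have hg : 0 < Nat.gcd d N := Nat.gcd_pos_of_pos_right _ hN
  calc T.card = (T.image fun y => y / y₀).card := by
        refine (Finset.card_image_of_injective _ fun x y h => ?_).symm
        exact (div_left_inj' (hne y₀ hy₀)).mp h
    _ ≤ (Polynomial.nthRoots (Nat.gcd d N) (1 : L)).toFinset.card := by
        refine Finset.card_le_card fun z hz => ?_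
        obtain ⟨y, hy, rfl⟩ := Finset.mem_image.mp hz
        rw [Multiset.mem_toFinset, Polynomial.mem_nthRoots hg]
        refine pow_gcd_eq_one.mpr ⟨?_, ?_⟩
        · rw [div_pow, (hT y hy).2, (hT y₀ hy₀).2, div_self]
          rw [← (hT y₀ hy₀).2]
          exact pow_ne_zero _ (hne y₀ hy₀)
        · rw [div_pow, (hT y hy).1, (hT y₀ hy₀).1, div_self one_ne_zero]
    _ ≤ _ := (Multiset.toFinset_card_le _).trans (Polynomial.card_nthRoots _ _)

/-- Two roots of the reciprocal quadratic `Y ^ 2 - c * Y + 1` are equal or mutually inverse. -/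
lemma eq_or_mul_eq_one_of_sq_add_one {L : Type*} [Field L] {y z c : L} (hy : y ^ 2 + 1 = c * y)
    (hz : z ^ 2 + 1 = c * z) : z = y ∨ z * y = 1 := by
  have : (z - y) * (z * y - 1) = 0 := by linear_combination y * hz - z * hy
  rcases mul_eq_zero.mp this with h | h
  · exact Or.inl (sub_eq_zero.mp h)
  · exact Or.inr (sub_eq_zero.mp h)

lemma ne_zero_of_sq_add_one {L : Type*} [Field L] {y c : L} (hy : y ^ 2 + 1 = c * y) : y ≠ 0 := by
  rintro rfl
  simp at hy

lemma exists_sq_add_one_eq {L : Type*} [Field L] [IsAlgClosed L] (c : L) :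
    ∃ y : L, y ^ 2 + 1 = c * y := by
  have hq : (Polynomial.X ^ 2 + Polynomial.C (-c) * Polynomial.X + Polynomial.C 1 :
      Polynomial L).degree = 2 := by
    simpa using Polynomial.degree_quadratic (a := (1 : L)) (b := -c) (c := 1) one_ne_zero
  obtain ⟨y, hy⟩ := IsAlgClosed.exists_root _ (by rw [hq]; exact two_ne_zero)
  refine ⟨y, ?_⟩
  simp [Polynomial.IsRoot] at hy
  linear_combination hy

/-- The substitution turning `x ^ d + (x + a) ^ d` into the Dickson form `y ^ d + y ^ (-d)`. -/
lemma dickson_substitution {L : Type*} [Field L] {p k d : ℕ} [Fact p.Prime] [CharP L p]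
    (hd : 2 * d = p ^ k + 1) {x a y : L} (h : 2 * y * (2 * x + a) = a * (y ^ 2 + 1)) :
    (4 * y) ^ d * ((x + a) ^ d + x ^ d) = 2 * a ^ d * ((y ^ d) ^ 2 + 1) := by
  have h1 : 4 * y * (x + a) = a * (y + 1) ^ 2 := by linear_combination h
  have h2 : 4 * y * x = a * (y - 1) ^ 2 := by linear_combination h
  rw [mul_add, ← mul_pow, ← mul_pow, h1, h2, mul_pow, mul_pow, ← pow_mul, ← pow_mul, hd,
    pow_succ, pow_succ, add_pow_char_pow, sub_pow_char_pow, ← pow_mul, mul_comm d 2, hd, pow_succ]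
  simp only [one_pow]
  ring

/-- A root of `Y ^ 2 - c * Y + 1` with `c` in the field of order `q` has order dividing `q - 1` or
`q + 1`. -/
lemma pow_card_sub_one_or_add_one {K L : Type*} [Field K] [Finite K] [Field L] [Algebra K L]
    {y : L} {c : K} (hy : y ^ 2 + 1 = algebraMap K L c * y) :
    y ^ (Nat.card K - 1) = 1 ∨ y ^ (Nat.card K + 1) = 1 := by
  have := Fintype.ofFinite K
  have hQ : 0 < Nat.card K := Nat.card_pos
  have hy0 := ne_zero_of_sq_add_one hy
  have hz : (y ^ Nat.card K) ^ 2 + 1 = algebraMap K L c * y ^ Nat.card K := by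
    have h := congrArg (FiniteField.frobeniusAlgHom K L) hy
    rw [map_add, map_mul, AlgHom.commutes, map_pow, map_one] at h
    simpa using h
  rcases eq_or_mul_eq_one_of_sq_add_one hy hz with h | h
  · left
    apply mul_right_cancel₀ hy0
    rw [← pow_succ, Nat.sub_add_cancel hQ, h, one_mul]
  · right
    rw [pow_succ, h]

lemma deltaCount_neg_one {K : Type*} [Field K] [Finite K] (d : ℕ) (a b : K) :
    deltaCount (fun x : K => x ^ d) (-1) a b =
      let := Fintype.ofFinite K
      (Finset.univ.filter fun x : K => (x + a) ^ d + x ^ d = b).card := by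
  let := Fintype.ofFinite K
  simp [deltaCount, Nat.card_eq_fintype_card, Fintype.card_subtype]

lemma deltaCount_zero_le {K : Type*} [Field K] [Finite K] {d : ℕ} (h2 : (2 : K) ≠ 0)
    (hd : 0 < d) (b : K) :
    deltaCount (fun x : K => x ^ d) (-1) 0 b ≤ Nat.gcd d (Nat.card K - 1) := by
  let := Fintype.ofFinite K
  have hQ : 0 < Nat.card K - 1 := Nat.sub_pos_of_lt Finite.one_lt_card
  rw [deltaCount_neg_one]
  by_cases hb : b = 0
  · calc _ ≤ ({0} : Finset K).card := by
          refine Finset.card_le_card fun x hx => ?_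
          have hx' := (Finset.mem_filter.mp hx).2
          rw [add_zero, hb, ← two_mul] at hx'
          simpa [h2, hd.ne'] using hx'
      _ ≤ _ := Nat.gcd_pos_of_pos_left _ hd
  · refine card_le_gcd_of_pow_eq _ hQ (b / 2) fun x hx => ?_
    have hx' := (Finset.mem_filter.mp hx).2
    rw [add_zero] at hx'
    have hx0 : x ≠ 0 := by
      rintro rfl
      rw [zero_pow hd.ne', add_zero] at hx'
      exact hb hx'.symm
    refine ⟨?_, ?_⟩
    · rw [Nat.card_eq_fintype_card]
      exact FiniteField.pow_card_sub_one_eq_one x hx0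
    · rw [← hx']
      field_simp
      ring

lemma deltaCount_le {K : Type*} (L : Type*) [Field K] [Finite K] [Field L]
    [Algebra K L] [IsAlgClosed L] {p k d : ℕ} [Fact p.Prime] [CharP K p]
    (h2 : (2 : K) ≠ 0) (hd : 2 * d = p ^ k + 1) {N₁ N₂ M : ℕ}
    (hN : (N₁ = Nat.card K - 1 ∧ N₂ = Nat.card K + 1) ∨
      (N₁ = Nat.card K + 1 ∧ N₂ = Nat.card K - 1))
    (hQ : Odd (Nat.card K)) (h₁ : Nat.gcd (2 * d) N₁ ∣ 2) (h₂ : Nat.gcd d N₂ ≤ M)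
    (hM : 2 ≤ M) (a b : K) : deltaCount (fun x : K => x ^ d) (-1) a b ≤ M := by
  let := Fintype.ofFinite K
  have hd0 : 0 < d := by omega
  have hQ1 : 1 < Nat.card K := Finite.one_lt_card
  have h₁' : Nat.gcd d N₁ ≤ M := (Nat.le_of_dvd two_pos
    ((Nat.gcd_dvd_gcd_of_dvd_left N₁ (Dvd.intro_left 2 rfl)).trans h₁)).trans hM
  by_cases ha : a = 0
  · subst ha
    refine (deltaCount_zero_le h2 hd0 b).trans ?_
    rcases hN with ⟨rfl, rfl⟩ | ⟨rfl, rfl⟩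
    · exact h₁'
    · exact h₂
  have : CharP L p := charP_of_injective_algebraMap (algebraMap K L).injective p
  have h2L : (2 : L) ≠ 0 := by
    rw [← map_ofNat (algebraMap K L) 2]
    simpa using h2
  have haL : algebraMap K L a ≠ 0 := by simpa using ha
  have h4L : (4 : L) ≠ 0 := by
    rw [show (4 : L) = 2 * 2 by norm_num]
    exact mul_ne_zero h2L h2L
  have hN₁ : 0 < N₁ := by omega
  have hN₂ : 0 < N₂ := by omega
  have hN₂e : Even N₂ := by
    rcases hN with ⟨-, rfl⟩ | ⟨-, rfl⟩
    · exact hQ.add_odd odd_one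
    · exact hQ.tsub_odd odd_one
  have hNN : Nat.gcd N₁ N₂ ∣ 2 := by
    have ha := Nat.gcd_dvd_left N₁ N₂
    have hb := Nat.gcd_dvd_right N₁ N₂
    rcases hN with ⟨h, h'⟩ | ⟨h, h'⟩
    · have := Nat.dvd_sub hb ha
      rwa [show N₂ - N₁ = 2 by omega] at this
    · have := Nat.dvd_sub ha hb
      rwa [show N₁ - N₂ = 2 by omega] at this
  obtain ⟨u, hu⟩ := exists_sq_add_one_eq
    ((4 : L) ^ d * algebraMap K L b / (2 * algebraMap K L a ^ d))
  rw [deltaCount_neg_one]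
  set S := Finset.univ.filter fun x : K => (x + a) ^ d + x ^ d = b with hS
  have key : ∀ x ∈ S, ∃ y : L, y ^ 2 + 1 = algebraMap K L (2 * (2 * x + a) / a) * y ∧
      y ^ d = u := by
    intro x hx
    have hxb := congrArg (algebraMap K L) (Finset.mem_filter.mp hx).2
    simp only [map_add, map_pow] at hxb
    obtain ⟨y, hy⟩ := exists_sq_add_one_eq (algebraMap K L (2 * (2 * x + a) / a))
    have hy0 := ne_zero_of_sq_add_one hy
    have hsub := dickson_substitution (L := L) (x := algebraMap K L x) (a := algebraMap K L a)
      (y := y) hd (by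
        rw [hy]
        simp only [map_div₀, map_mul, map_add, map_ofNat]
        field_simp)
    rw [hxb] at hsub
    have hyd : (y ^ d) ^ 2 + 1 =
        (4 : L) ^ d * algebraMap K L b / (2 * algebraMap K L a ^ d) * y ^ d := by
      rw [mul_pow] at hsub
      field_simp
      linear_combination -hsub
    rcases eq_or_mul_eq_one_of_sq_add_one hu hyd with h | h
    · exact ⟨y, hy, h⟩
    · refine ⟨y⁻¹, ?_, ?_⟩
      · field_simp
        linear_combination hy
      · rw [inv_pow]
        exact inv_eq_of_mul_eq_one_right h
  choose! f hf hfu using key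
  have hinj : Set.InjOn f S := by
    intro x hx x' hx' h
    have h1 := hf x hx
    have h2' := hf x' hx'
    rw [← h, h1] at h2'
    have h3 := mul_right_cancel₀ (ne_zero_of_sq_add_one h1) h2'
    have h4 := (algebraMap K L).injective h3
    rw [div_left_inj' ha] at h4
    have h5 := add_right_cancel (mul_left_cancel₀ h2 h4)
    exact mul_left_cancel₀ h2 h5
  have hor : ∀ x ∈ S, f x ^ N₁ = 1 ∨ f x ^ N₂ = 1 := by
    intro x hx
    have := pow_card_sub_one_or_add_one (hf x hx)
    rcases hN with ⟨rfl, rfl⟩ | ⟨rfl, rfl⟩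
    · exact this
    · exact this.symm
  have hall : (∀ x ∈ S, f x ^ N₁ = 1) ∨ (∀ x ∈ S, f x ^ N₂ = 1) := by
    by_contra! hcon
    obtain ⟨⟨x, hx, hx1⟩, ⟨z, hz, hz2⟩⟩ := hcon
    have hx2 := (hor x hx).resolve_left hx1
    have hz1 := (hor z hz).resolve_right hz2
    have hu1 : u ^ N₁ = 1 := by rw [← hfu z hz, ← pow_mul, mul_comm, pow_mul, hz1, one_pow]
    have hu2 : u ^ N₂ = 1 := by rw [← hfu x hx, ← pow_mul, mul_comm, pow_mul, hx2, one_pow]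
    have husq : u ^ 2 = 1 := by
      obtain ⟨c, hc⟩ := hNN
      rw [hc, pow_mul, pow_gcd_eq_one.mpr ⟨hu1, hu2⟩, one_pow]
    have hzd : f z ^ (2 * d) = 1 := by rw [mul_comm, pow_mul, hfu z hz, husq]
    have hzsq : f z ^ 2 = 1 := by
      obtain ⟨c, hc⟩ := h₁
      rw [hc, pow_mul, pow_gcd_eq_one.mpr ⟨hzd, hz1⟩, one_pow]
    obtain ⟨c, hc⟩ := hN₂e.two_dvd
    exact hz2 (by rw [hc, pow_mul, hzsq, one_pow])
  rw [← Finset.card_image_of_injOn hinj]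
  rcases hall with h | h
  · refine (card_le_gcd_of_pow_eq _ hN₁ u fun y hy => ?_).trans h₁'
    obtain ⟨x, hx, rfl⟩ := Finset.mem_image.mp hy
    exact ⟨h x hx, hfu x hx⟩
  · refine (card_le_gcd_of_pow_eq _ hN₂ u fun y hy => ?_).trans h₂
    obtain ⟨x, hx, rfl⟩ := Finset.mem_image.mp hy
    exact ⟨h x hx, hfu x hx⟩

lemma exists_isPrimitiveRoot_of_dvd_card_sub_one {K : Type*} [Field K] [Finite K] {M : ℕ}
    (hM : M ∣ Nat.card K - 1) : ∃ η : K, IsPrimitiveRoot η M := by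
  obtain ⟨g, hg⟩ := IsCyclic.exists_generator (α := Kˣ)
  have ho : orderOf g = Nat.card K - 1 := by
    rw [orderOf_eq_card_of_forall_mem_zpowers hg, Nat.card_units]
  have h1 : IsPrimitiveRoot (g : K) (Nat.card K - 1) := by
    rw [IsPrimitiveRoot.coe_units_iff, ← ho]
    exact IsPrimitiveRoot.orderOf g
  obtain ⟨c, hc⟩ := hM
  exact ⟨_, h1.pow (Nat.sub_pos_of_lt Finite.one_lt_card) (hc.trans (mul_comm _ _))⟩

lemma exists_le_deltaCount_of_dvd_card_sub_one {K : Type*} [Field K] [Finite K] {M d : ℕ}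
    (hM : M ∣ Nat.card K - 1) (hMd : M ∣ d) :
    ∃ a b : K, M ≤ deltaCount (fun x : K => x ^ d) (-1) a b := by
  let := Fintype.ofFinite K
  obtain ⟨η, hη⟩ := exists_isPrimitiveRoot_of_dvd_card_sub_one hM
  refine ⟨0, 1 + 1, ?_⟩
  rw [deltaCount_neg_one, ← Finset.card_range M]
  refine Finset.card_le_card_of_injOn (fun i => η ^ i) (fun i _ => ?_) ?_
  · have : (η ^ i) ^ d = 1 := by
      rw [← pow_mul, mul_comm, pow_mul, (hη.pow_eq_one_iff_dvd d).mpr hMd, one_pow]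
    simp [this]
  · intro i hi j hj h
    exact hη.pow_inj (Finset.mem_range.mp hi) (Finset.mem_range.mp hj) h

lemma mem_range_algebraMap_of_pow_card_eq {K L : Type*} [Field K] [Fintype K] [Field L]
    [Algebra K L] {z : L} (hz : z ^ Fintype.card K = z) : ∃ x : K, algebraMap K L x = z := by
  have hne := FiniteField.X_pow_card_sub_X_ne_zero L (Fintype.one_lt_card (α := K))
  have hsub : Finset.univ.image (algebraMap K L) ⊆
      (Polynomial.X ^ Fintype.card K - Polynomial.X : Polynomial L).roots.toFinset := by
    intro w hw
    obtain ⟨x, -, rfl⟩ := Finset.mem_image.mp hw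
    simp [hne, ← map_pow, FiniteField.pow_card]
  have heq := Finset.eq_of_subset_of_card_le hsub (by
    rw [Finset.card_image_of_injective _ (algebraMap K L).injective, Finset.card_univ]
    refine (Multiset.toFinset_card_le _).trans ((Polynomial.card_roots' _).trans_eq ?_)
    exact FiniteField.X_pow_card_sub_X_natDegree_eq L Fintype.one_lt_card)
  have hmem : z ∈ Finset.univ.image (algebraMap K L) := by
    rw [heq]
    simp [hne, hz]
  simpa using hmem

lemma exists_le_deltaCount_of_dvd_card_add_one {K : Type*} (L : Type*) [Field K] [Finite K]
    [Field L] [Algebra K L] [IsAlgClosed L] {p k d M : ℕ} [Fact p.Prime] [CharP K p]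
    (h2 : (2 : K) ≠ 0) (hd : 2 * d = p ^ k + 1)
    (hM : M ∣ Nat.card K + 1) (hMd : M ∣ d) (hlt : 2 * d < Nat.card K + 1) :
    ∃ a b : K, M ≤ deltaCount (fun x : K => x ^ d) (-1) a b := by
  let := Fintype.ofFinite K
  have : CharP L p := charP_of_injective_algebraMap (algebraMap K L).injective p
  have h2L : (2 : L) ≠ 0 := by
    rw [← map_ofNat (algebraMap K L) 2]
    simpa using h2
  have h4L : (4 : L) ≠ 0 := by
    rw [show (4 : L) = 2 * 2 by norm_num]
    exact mul_ne_zero h2L h2L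
  have hcard : ((Nat.card K : ℕ) : L) = 0 := by
    rw [Nat.card_eq_fintype_card, ← map_natCast (algebraMap K L)]
    simp
  have : NeZero ((Nat.card K + 1 : ℕ) : L) := ⟨by push_cast; rw [hcard]; simp⟩
  obtain ⟨ζ, hζ⟩ := HasEnoughRootsOfUnity.exists_primitiveRoot L (Nat.card K + 1)
  obtain ⟨c, hc⟩ := hM
  have hη : IsPrimitiveRoot (ζ ^ c) M := hζ.pow (Nat.succ_pos _) (hc.trans (mul_comm _ _))
  set y : ℕ → L := fun i => ζ * (ζ ^ c) ^ i with hy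
  have hζ0 : ζ ≠ 0 := hζ.ne_zero (Nat.succ_ne_zero _)
  have hy0 : ∀ i, y i ≠ 0 := fun i => mul_ne_zero hζ0 (pow_ne_zero _ (pow_ne_zero _ hζ0))
  have hyd : ∀ i, y i ^ d = ζ ^ d := fun i => by
    rw [hy]
    dsimp only
    rw [mul_pow, ← pow_mul (ζ ^ c), mul_comm i, pow_mul, (hη.pow_eq_one_iff_dvd d).mpr hMd,
      one_pow, mul_one]
  have hyQ : ∀ i, y i ^ Nat.card K = (y i)⁻¹ := fun i => by
    refine eq_inv_of_mul_eq_one_left ?_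
    rw [← pow_succ, hy]
    dsimp only
    rw [mul_pow, ← pow_mul ζ, ← pow_mul ζ (c * i), mul_comm (c * i),
      pow_mul ζ (Nat.card K + 1), hζ.pow_eq_one, one_pow, mul_one]
  have hx : ∀ i, ∃ x : K, algebraMap K L x = (y i + (y i)⁻¹) := fun i => by
    have hfix : (y i + (y i)⁻¹) ^ Fintype.card K = y i + (y i)⁻¹ := by
      have h := map_add (FiniteField.frobeniusAlgHom K L) (y i) (y i)⁻¹
      simp only [FiniteField.coe_frobeniusAlgHom] at h
      rw [h, inv_pow, ← Nat.card_eq_fintype_card, hyQ, inv_inv, add_comm]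
    exact mem_range_algebraMap_of_pow_card_eq hfix
  choose x hx using hx
  have hxs : ∀ i, y i ^ 2 + 1 = algebraMap K L (x i) * y i := fun i => by
    rw [hx]
    rw [add_mul, inv_mul_cancel₀ (hy0 i), sq]
  have hval : ∀ i, ((x i - 2) + 4) ^ d + (x i - 2) ^ d = ((x 0 - 2) + 4) ^ d + (x 0 - 2) ^ d := by
    have hform : ∀ i, (4 * ζ) ^ d * algebraMap K L (((x i - 2) + 4) ^ d + (x i - 2) ^ d) =
        2 * 4 ^ d * ((ζ ^ d) ^ 2 + 1) := fun i => by
      have h := dickson_substitution (L := L) (x := algebraMap K L (x i) - 2) (a := 4)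
        (y := y i) hd (by linear_combination -4 * hxs i)
      rw [hyd, mul_pow, hyd, ← mul_pow] at h
      simpa [map_ofNat] using h
    intro i
    apply (algebraMap K L).injective
    exact mul_left_cancel₀ (pow_ne_zero d (mul_ne_zero h4L hζ0)) ((hform i).trans (hform 0).symm)
  refine ⟨4, ((x 0 - 2) + 4) ^ d + (x 0 - 2) ^ d, ?_⟩
  rw [deltaCount_neg_one, ← Finset.card_range M]
  refine Finset.card_le_card_of_injOn (fun i => x i - 2) (fun i _ => ?_) ?_
  · simpa using hval i
  · intro i hi j hj h
    have hxx : x i = x j := sub_left_injective h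
    have hi' := hxs i
    rw [hxx] at hi'
    rcases eq_or_mul_eq_one_of_sq_add_one hi' (hxs j) with h' | h'
    · exact (hη.pow_inj (Finset.mem_range.mp hj) (Finset.mem_range.mp hi)
        (mul_left_cancel₀ hζ0 h')).symm
    · exfalso
      have hd1 := congrArg (· ^ d) h'
      simp only [mul_pow, hyd, one_pow] at hd1
      rw [← pow_add, ← two_mul] at hd1
      have := Nat.le_of_dvd (by omega) ((hζ.pow_eq_one_iff_dvd _).mp hd1)
      omega

lemma pow_eq_neg_one_pow_of_pow_eq {R : Type*} [CommRing R] {P : R} {k n : ℕ} (hk : Odd k)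
    (hkn : Nat.Coprime k n) (hPk : P ^ k = -1) (hPn : P ^ (2 * n) = 1) : P = -1 := by
  have h1 : P ^ (2 * k) = 1 := by rw [mul_comm, pow_mul, hPk]; norm_num
  have h2 := pow_gcd_eq_one.mpr ⟨h1, hPn⟩
  rw [Nat.gcd_mul_left, hkn.gcd_eq_one, mul_one] at h2
  obtain ⟨j, rfl⟩ := hk
  rwa [pow_succ, pow_mul, h2, one_pow, one_mul] at hPk

lemma natCast_eq_neg_one_of_dvd {e P k : ℕ} (h : e ∣ P ^ k + 1) : (P : ZMod e) ^ k = -1 := by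
  have := (ZMod.natCast_eq_zero_iff _ _).mpr h
  push_cast at this
  exact eq_neg_of_add_eq_zero_left this

lemma natCast_eq_one_of_dvd {e P n : ℕ} (hP : 0 < P) (h : e ∣ P ^ n - 1) :
    (P : ZMod e) ^ n = 1 := by
  have := (ZMod.natCast_eq_zero_iff _ _).mpr h
  rw [Nat.cast_sub (Nat.one_le_pow _ _ hP)] at this
  push_cast at this
  exact sub_eq_zero.mp this

lemma dvd_two_of_one_eq_neg_one {e : ℕ} (h : (1 : ZMod e) = -1) : e ∣ 2 := by
  rw [← ZMod.natCast_eq_zero_iff]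
  push_cast
  linear_combination h

lemma dvd_add_one_of_natCast_eq {e P : ℕ} (h : (P : ZMod e) = -1) : e ∣ P + 1 := by
  rw [← ZMod.natCast_eq_zero_iff]
  push_cast
  linear_combination h

/-- For odd `P` and odd `k`, the quotient of `P ^ k + 1` by `P + 1` is odd. -/
lemma exists_odd_mul_eq_pow_add_one {P k : ℕ} (hP : Odd P) (hk : Odd k) :
    ∃ w, P ^ k + 1 = (P + 1) * (2 * w + 1) := by
  obtain ⟨j, rfl⟩ := hk
  obtain ⟨r, rfl⟩ := hP
  have h : (2 * r + 1) ^ 2 - 1 ∣ ((2 * r + 1) ^ 2) ^ j - 1 := by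
    simpa using Nat.sub_dvd_pow_sub_pow ((2 * r + 1) ^ 2) 1 j
  obtain ⟨v, hv⟩ := h
  have h1 : 1 ≤ ((2 * r + 1) ^ 2) ^ j := Nat.one_le_pow _ _ (by positivity)
  have h2 : (2 * r + 1) ^ 2 - 1 = 2 * r * (2 * r + 2) := by
    rw [Nat.sub_eq_iff_eq_add (Nat.one_le_pow _ _ (by positivity))]
    ring
  rw [h2] at hv
  have hv' : ((2 * r + 1) ^ 2) ^ j = 2 * r * (2 * r + 2) * v + 1 := by omega
  refine ⟨r * v * (2 * r + 1), ?_⟩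
  rw [pow_succ, pow_mul, hv']
  ring

lemma gcd_half_pow_add_one_le {P k N d : ℕ} (hP : Odd P) (hk : Odd k) (hd : 2 * d = P ^ k + 1)
    (h : Nat.gcd (2 * d) N ∣ P + 1) : Nat.gcd d N ≤ (P + 1) / 2 := by
  obtain ⟨w, hw⟩ := exists_odd_mul_eq_pow_add_one hP hk
  obtain ⟨r, rfl⟩ := hP
  rw [show (2 * r + 1 + 1) / 2 = r + 1 by omega]
  have hdw : d = (r + 1) * (2 * w + 1) := by
    apply Nat.eq_of_mul_eq_mul_left two_pos
    rw [hd, hw]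
    ring
  have h1 : Nat.gcd d N ∣ (r + 1) * 2 := by
    have := (Nat.gcd_dvd_gcd_of_dvd_left N (Dvd.intro_left 2 rfl)).trans h
    rwa [show 2 * r + 1 + 1 = (r + 1) * 2 by ring] at this
  have h2 : Nat.gcd d N ∣ (r + 1) * (2 * w + 1) := hdw ▸ Nat.gcd_dvd_left d N
  have h3 := Nat.dvd_gcd h1 h2
  rw [Nat.gcd_mul_left, show Nat.gcd 2 (2 * w + 1) = 1 by simp, mul_one] at h3
  exact Nat.le_of_dvd (Nat.succ_pos r) h3

lemma half_add_one_dvd_half_pow_add_one {P k d : ℕ} (hP : Odd P) (hk : Odd k)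
    (hd : 2 * d = P ^ k + 1) : (P + 1) / 2 ∣ d := by
  obtain ⟨w, hw⟩ := exists_odd_mul_eq_pow_add_one hP hk
  obtain ⟨r, rfl⟩ := hP
  rw [show (2 * r + 1 + 1) / 2 = r + 1 by omega]
  refine ⟨2 * w + 1, Nat.eq_of_mul_eq_mul_left two_pos ?_⟩
  rw [hd, hw]
  ring

lemma odd_div_gcd_of_even {n k : ℕ} (hn : 0 < n)
    (h : Even (2 * n / Nat.gcd (2 * n) k)) : Odd (k / Nat.gcd k n) := by
  have hg : 0 < Nat.gcd k n := Nat.gcd_pos_of_pos_right _ hn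
  obtain ⟨g, k', n', hg', hco, rfl, rfl⟩ := Nat.exists_coprime' hg
  rw [Nat.gcd_mul_right, hco.gcd_eq_one, one_mul, Nat.mul_div_cancel _ hg']
  rw [← mul_assoc, Nat.gcd_mul_right, Nat.mul_div_mul_right _ _ hg',
    Nat.Coprime.gcd_mul_right_cancel _ hco.symm] at h
  by_contra hk'
  rw [Nat.not_odd_iff_even] at hk'
  rw [Nat.gcd_eq_left hk'.two_dvd, Nat.mul_div_cancel_left _ two_pos] at h
  have := Nat.dvd_gcd hk'.two_dvd h.two_dvd
  rw [hco.gcd_eq_one] at this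
  omega

lemma cDiffUniformity_eq_of_forall_le {K : Type*} [Field K] [Finite K] {f : K → K} {c : K}
    {M : ℕ} (hc : c ≠ 1) (hle : ∀ a b, deltaCount f c a b ≤ M)
    (hge : ∃ a b, M ≤ deltaCount f c a b) : cDiffUniformity f c = M := by
  obtain ⟨a, b, hab⟩ := hge
  refine le_antisymm (Finset.sup_le fun ab _ => hle _ _) (hab.trans ?_)
  unfold cDiffUniformity
  let := Fintype.ofFinite K
  exact Finset.le_sup (f := fun ab : K × K => deltaCount f c ab.1 ab.2) (b := (a, b))
    (by simp [hc])

theorem stmt_8 (p n k : ℕ) [Fact p.Prime] (hodd : Odd p) (hk : 1 ≤ k) (hkn : k < n)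
    (hn : 3 ≤ n) (heven : Even (2 * n / Nat.gcd (2 * n) k)) :
    cDiffUniformity
        (fun x : GaloisField p n => x ^ ((p ^ k + 1) / 2)) (-1 : GaloisField p n) =
      (p ^ Nat.gcd k n + 1) / 2 := by
  have hp : p.Prime := Fact.out
  have hcard : Nat.card (GaloisField p n) = p ^ n := GaloisField.card p n (by omega)
  have hp3 : 3 ≤ p := by
    have := hp.two_le
    obtain ⟨r, rfl⟩ := hodd
    omega
  have h2 : (2 : GaloisField p n) ≠ 0 := by
    intro h
    have h' : ((2 : ℕ) : GaloisField p n) = 0 := by exact_mod_cast h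
    rw [CharP.cast_eq_zero_iff (GaloisField p n) p] at h'
    have := Nat.le_of_dvd two_pos h'
    omega
  have hneg : (-1 : GaloisField p n) ≠ 1 := fun h => h2 (by linear_combination -h)
  have hoddk := odd_div_gcd_of_even (by omega : 0 < n) heven
  have hg : 0 < Nat.gcd k n := Nat.gcd_pos_of_pos_left _ hk
  have hco := Nat.coprime_div_gcd_div_gcd hg
  have hk' : k = Nat.gcd k n * (k / Nat.gcd k n) :=
    (Nat.mul_div_cancel' (Nat.gcd_dvd_left k n)).symm
  have hn' : n = Nat.gcd k n * (n / Nat.gcd k n) :=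
    (Nat.mul_div_cancel' (Nat.gcd_dvd_right k n)).symm
  set g := Nat.gcd k n
  set k' := k / g
  set n' := n / g
  set P := p ^ g with hPdef
  have hP : Odd P := hodd.pow
  have hP3 : 3 ≤ P := hp3.trans (Nat.le_self_pow hg.ne' p)
  have hpk : p ^ k = P ^ k' := by rw [hPdef, ← pow_mul, ← hk']
  have hpn : p ^ n = P ^ n' := by rw [hPdef, ← pow_mul, ← hn']
  obtain ⟨d, hd⟩ := (hodd.pow (n := k)).add_odd odd_one |>.two_dvd
  rw [show (p ^ k + 1) / 2 = d by omega]
  have hd' : 2 * d = P ^ k' + 1 := by rw [← hd, hpk]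
  have hM : 2 ≤ (P + 1) / 2 := by omega
  have hMP : (P + 1) / 2 ∣ P + 1 := Nat.div_dvd_of_dvd (hP.add_odd odd_one).two_dvd
  have hMd := half_add_one_dvd_half_pow_add_one hP hoddk hd'
  have hplus : ∀ e, e ∣ 2 * d → e ∣ P ^ n' + 1 → (P : ZMod e) = -1 := fun e h h' => by
    refine pow_eq_neg_one_pow_of_pow_eq hoddk hco (natCast_eq_neg_one_of_dvd (hd' ▸ h)) ?_
    rw [mul_comm, pow_mul, natCast_eq_neg_one_of_dvd h']
    norm_num
  have hminus : ∀ e, e ∣ 2 * d → e ∣ P ^ n' - 1 → (P : ZMod e) = -1 := fun e h h' => by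
    refine pow_eq_neg_one_pow_of_pow_eq hoddk hco (natCast_eq_neg_one_of_dvd (hd' ▸ h)) ?_
    rw [mul_comm, pow_mul, natCast_eq_one_of_dvd (by omega) h', one_pow]
  have hcardodd : Odd (Nat.card (GaloisField p n)) := hcard ▸ hodd.pow
  apply cDiffUniformity_eq_of_forall_le hneg
  · rcases Nat.even_or_odd n' with hn'e | hn'o
    · refine deltaCount_le (AlgebraicClosure (GaloisField p n)) (p := p) (k := k) h2 hd.symm
        (Or.inr ⟨rfl, rfl⟩) hcardodd ?_
        (gcd_half_pow_add_one_le hP hoddk hd' ?_) hM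
      · rw [hcard, hpn]
        have h := hplus _ (Nat.gcd_dvd_left (2 * d) (P ^ n' + 1)) (Nat.gcd_dvd_right _ _)
        have h' := natCast_eq_neg_one_of_dvd (Nat.gcd_dvd_right (2 * d) (P ^ n' + 1))
        rw [h, hn'e.neg_one_pow] at h'
        exact dvd_two_of_one_eq_neg_one h'
      · rw [hcard, hpn]
        exact dvd_add_one_of_natCast_eq (hminus _ (Nat.gcd_dvd_left _ _) (Nat.gcd_dvd_right _ _))
    · refine deltaCount_le (AlgebraicClosure (GaloisField p n)) (p := p) (k := k) h2 hd.symm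
        (Or.inl ⟨rfl, rfl⟩) hcardodd ?_
        (gcd_half_pow_add_one_le hP hoddk hd' ?_) hM
      · rw [hcard, hpn]
        have h := hminus _ (Nat.gcd_dvd_left (2 * d) (P ^ n' - 1)) (Nat.gcd_dvd_right _ _)
        have h' := natCast_eq_one_of_dvd (by omega) (Nat.gcd_dvd_right (2 * d) (P ^ n' - 1))
        rw [h, hn'o.neg_one_pow] at h'
        exact dvd_two_of_one_eq_neg_one h'.symm
      · rw [hcard, hpn]
        exact dvd_add_one_of_natCast_eq (hplus _ (Nat.gcd_dvd_left _ _) (Nat.gcd_dvd_right _ _))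
  · rcases Nat.even_or_odd n' with hn'e | hn'o
    · refine exists_le_deltaCount_of_dvd_card_sub_one ?_ hMd
      rw [hcard, hpn]
      refine hMP.trans ?_
      obtain ⟨j, hj⟩ := hn'e.two_dvd
      rw [hj, pow_mul]
      have h := Nat.sub_dvd_pow_sub_pow (P ^ 2) 1 j
      rw [one_pow] at h
      refine Dvd.dvd.trans ⟨P - 1, ?_⟩ h
      simpa using Nat.sq_sub_sq P 1
    · refine exists_le_deltaCount_of_dvd_card_add_one (AlgebraicClosure (GaloisField p n))
        (p := p) (k := k) h2 hd.symm ?_ hMd ?_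
      · rw [hcard, hpn]
        refine hMP.trans ?_
        simpa using hn'o.nat_add_dvd_pow_add_pow P 1
      · rw [hcard, ← hd]
        exact Nat.succ_lt_succ (Nat.pow_lt_pow_right (by omega) hkn)
end

section
/- Let p be an odd prime, n a positive integer, and F : GF(p^n) → GF(p^n) the power function F(x) = x^d with d = (p^n + 1)/2. For every c ∈ GF(p^n) with c ≠ 1 and c ≠ −1, the c-differential uniformity of F is at most 4. -/
open scoped Classical

/-- If `f y = ±y` for every `y` and `c ≠ ±1`, then each choice of signs for `f (x + a)` and `f x`
leaves at most one solution of `f (x + a) - c * f x = b`. -/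
theorem deltaCount_le_four_of_eq_or_eq_neg {F : Type*} [Field F] [Finite F] {f : F → F}
    (hf : ∀ y, f y = y ∨ f y = -y) {c : F} (hc1 : c ≠ 1) (hc2 : c ≠ -1) (a b : F) :
    deltaCount f c a b ≤ 4 := by
  have h1 : 1 - c ≠ 0 := fun h => hc1 (by linear_combination -h)
  have h2 : 1 + c ≠ 0 := fun h => hc2 (by linear_combination h)
  let g : {x : F // f (x + a) - c * f x = b} → Prop × Prop :=
    fun x => (f (x + a) = x + a, f x = x)
  have hg : Function.Injective g := by
    rintro ⟨x, hx⟩ ⟨y, hy⟩ hxy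
    simp only [g, Prod.mk.injEq, eq_iff_iff] at hxy
    obtain ⟨hxya, hxy0⟩ := hxy
    apply Subtype.ext
    change x = y
    have sign_eq : ∀ u v : F, (f u = u ↔ f v = v) →
        (f u = u ∧ f v = v) ∨ (f u = -u ∧ f v = -v) := by
      intro u v h
      have hu := hf u
      have hv := hf v
      tauto
    rcases sign_eq _ _ hxya with ⟨e1, e2⟩ | ⟨e1, e2⟩ <;>
      rcases sign_eq _ _ hxy0 with ⟨e3, e4⟩ | ⟨e3, e4⟩ <;>
      rw [e1, e3] at hx <;> rw [e2, e4] at hy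
    · exact mul_left_cancel₀ h1 (by linear_combination hx - hy)
    · exact mul_left_cancel₀ h2 (by linear_combination hx - hy)
    · exact mul_left_cancel₀ h2 (by linear_combination hy - hx)
    · exact mul_left_cancel₀ h1 (by linear_combination hy - hx)
  calc deltaCount f c a b ≤ Nat.card (Prop × Prop) := Nat.card_le_card_of_injective g hg
    _ = 4 := by simp [Nat.card_eq_fintype_card]

theorem stmt_9 (p n : ℕ) [Fact p.Prime] (hodd : Odd p) (hn : 0 < n)
    (c : GaloisField p n) (hc1 : c ≠ 1) (hc2 : c ≠ -1) :
    cDiffUniformity (fun x : GaloisField p n => x ^ ((p ^ n + 1) / 2)) c ≤ 4 := by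
  refine Finset.sup_le fun ab _ =>
    deltaCount_le_four_of_eq_or_eq_neg (fun y => ?_) hc1 hc2 ab.1 ab.2
  have hcard : y ^ p ^ n = y := by
    have : Fintype (GaloisField p n) := Fintype.ofFinite _
    rw [← GaloisField.card p n hn.ne', Nat.card_eq_fintype_card]
    exact FiniteField.pow_card y
  have heven : (p ^ n + 1) / 2 * 2 = p ^ n + 1 :=
    Nat.div_mul_cancel (hodd.pow.add_odd odd_one).two_dvd
  apply sq_eq_sq_iff_eq_or_eq_neg.mp
  rw [← pow_mul, heven, pow_succ, hcard, sq]
end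

section
/- Let p be an odd prime, n a positive integer with p^n ≡ 1 (mod 4), and F : GF(p^n) → GF(p^n) the power function F(x) = x^d with d = (p^n + 1)/2. If c ∈ GF(p^n) with c ≠ ±1 satisfies η((1−c)/(1+c)) = 1, i.e., (1−c)/(1+c) is a nonzero square in GF(p^n), then the c-differential uniformity of F is at most 2. -/
open scoped Classical

section SignedIdentity

variable {K : Type*} [Field K] [Fintype K]

theorem quadraticChar_trichotomy (x : K) :
    quadraticChar K x = 0 ∨ quadraticChar K x = 1 ∨ quadraticChar K x = -1 := by
  by_cases hx : x = 0
  · exact Or.inl (quadraticChar_eq_zero_iff.mpr hx)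
  · exact Or.inr (quadraticChar_dichotomy hx)

theorem eq_of_mul_signed_sub_eq {α β u v : K}
    (hneg : quadraticChar K (-1) = 1)
    (hχ : quadraticChar K (α - β) = quadraticChar K (α + β))
    (hsub : α - β ≠ 0) (hadd : α + β ≠ 0)
    (h : α * (quadraticChar K u * u - quadraticChar K v * v) = β * (u - v)) : u = v := by
  have hχ0 : quadraticChar K (α + β) ≠ 0 := mt quadraticChar_eq_zero_iff.mp hadd
  have same_sign_of {w z : K} (hwz : (α - β) * w = -1 * ((α + β) * z)) :
      quadraticChar K w = quadraticChar K z := by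
    have hwz' := congrArg (quadraticChar K) hwz
    simp only [map_mul, hneg, hχ, one_mul] at hwz'
    exact mul_left_cancel₀ hχ0 hwz'
  rcases quadraticChar_trichotomy u with hu | hu | hu <;>
  rcases quadraticChar_trichotomy v with hv | hv | hv <;>
  simp only [hu, hv, Int.cast_zero, Int.cast_one, Int.cast_neg] at h
  · rw [quadraticChar_eq_zero_iff.mp hu, quadraticChar_eq_zero_iff.mp hv]
  · rw [quadraticChar_eq_zero_iff.mp hu] at h ⊢
    exact mul_left_cancel₀ hsub (by linear_combination h)
  · rw [quadraticChar_eq_zero_iff.mp hu] at h ⊢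
    exact mul_left_cancel₀ hadd (by linear_combination -h)
  · rw [quadraticChar_eq_zero_iff.mp hv] at h ⊢
    exact mul_left_cancel₀ hsub (by linear_combination h)
  · exact mul_left_cancel₀ hsub (by linear_combination h)
  · have := same_sign_of (w := u) (z := v) (by linear_combination h)
    omega
  · rw [quadraticChar_eq_zero_iff.mp hv] at h ⊢
    exact mul_left_cancel₀ hadd (by linear_combination -h)
  · have := same_sign_of (w := v) (z := u) (by linear_combination -h)
    omega
  · exact mul_left_cancel₀ hadd (by linear_combination -h)

theorem quadraticChar_neg_eq (hneg : quadraticChar K (-1) = 1) (x : K) :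
    quadraticChar K (-x) = quadraticChar K x := by
  rw [neg_eq_neg_one_mul, map_mul, hneg, one_mul]

theorem quadraticChar_add_injOn_solutions {a b c : K}
    (hneg : quadraticChar K (-1) = 1)
    (hc : quadraticChar K (1 - c) = quadraticChar K (1 + c))
    (h1 : 1 - c ≠ 0) (h2 : 1 + c ≠ 0) {x y : K}
    (hx : (quadraticChar K (x + a) : K) * (x + a) - c * (quadraticChar K x * x) = b)
    (hy : (quadraticChar K (y + a) : K) * (y + a) - c * (quadraticChar K y * y) = b)
    (h : quadraticChar K (x + a) = quadraticChar K (y + a)) : x = y := by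
  have hc' : quadraticChar K (c - 1) = quadraticChar K (c + 1) := by
    rw [← neg_sub, quadraticChar_neg_eq hneg, hc, add_comm]
  have hs1 : c - 1 ≠ 0 := by rwa [← neg_sub, neg_ne_zero]
  have hs2 : c + 1 ≠ 0 := by rwa [add_comm]
  rw [← h] at hy
  rcases quadraticChar_trichotomy (x + a) with hs | hs | hs
  · rw [hs, eq_comm, quadraticChar_eq_zero_iff] at h
    exact add_right_cancel ((quadraticChar_eq_zero_iff.mp hs).trans h.symm)
  · rw [hs, Int.cast_one] at hx hy
    exact eq_of_mul_signed_sub_eq hneg hc' hs1 hs2 (by linear_combination hy - hx)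
  · rw [hs, Int.cast_neg, Int.cast_one] at hx hy
    refine eq_of_mul_signed_sub_eq (α := c) (β := -1) hneg ?_ ?_ ?_
      (by linear_combination hy - hx)
    · rw [sub_neg_eq_add, ← sub_eq_add_neg, hc']
    · rwa [sub_neg_eq_add]
    · rwa [← sub_eq_add_neg]

theorem quadraticChar_injOn_solutions {a b c : K}
    (hneg : quadraticChar K (-1) = 1)
    (hc : quadraticChar K (1 - c) = quadraticChar K (1 + c))
    (h1 : 1 - c ≠ 0) (h2 : 1 + c ≠ 0) {x y : K}
    (hx : (quadraticChar K (x + a) : K) * (x + a) - c * (quadraticChar K x * x) = b)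
    (hy : (quadraticChar K (y + a) : K) * (y + a) - c * (quadraticChar K y * y) = b)
    (h : quadraticChar K x = quadraticChar K y) : x = y := by
  rw [← h] at hy
  apply add_right_cancel (b := a)
  rcases quadraticChar_trichotomy x with ht | ht | ht
  · rw [ht, eq_comm, quadraticChar_eq_zero_iff] at h
    rw [quadraticChar_eq_zero_iff.mp ht, h]
  · rw [ht, Int.cast_one] at hx hy
    exact eq_of_mul_signed_sub_eq hneg hc h1 h2 (by linear_combination hx - hy)
  · rw [ht, Int.cast_neg, Int.cast_one] at hx hy
    refine eq_of_mul_signed_sub_eq (α := 1) (β := -c) hneg ?_ ?_ ?_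
      (by linear_combination hx - hy)
    · rw [sub_neg_eq_add, ← sub_eq_add_neg, hc]
    · rwa [sub_neg_eq_add]
    · rwa [← sub_eq_add_neg]

theorem deltaCount_signed_identity_le_two {a b c : K}
    (hneg : quadraticChar K (-1) = 1)
    (hc : quadraticChar K (1 - c) = quadraticChar K (1 + c))
    (h1 : 1 - c ≠ 0) (h2 : 1 + c ≠ 0) :
    deltaCount (fun x : K => (quadraticChar K x : K) * x) c a b ≤ 2 := by
  by_contra! hlt
  rw [deltaCount, Nat.card_eq_fintype_card, Fintype.two_lt_card_iff] at hlt
  obtain ⟨⟨x, hx⟩, ⟨y, hy⟩, ⟨z, hz⟩, hxy, hxz, hyz⟩ := hlt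
  simp only [ne_eq, Subtype.mk.injEq] at hxy hxz hyz
  have add_ne {u v : K} := quadraticChar_add_injOn_solutions (x := u) (y := v)
    (a := a) (b := b) hneg hc h1 h2
  have ne {u v : K} := quadraticChar_injOn_solutions (x := u) (y := v)
    (a := a) (b := b) hneg hc h1 h2
  have hxy' := mt (add_ne hx hy) hxy
  have hxz' := mt (add_ne hx hz) hxz
  have hyz' := mt (add_ne hy hz) hyz
  have hxy'' := mt (ne hx hy) hxy
  have hxz'' := mt (ne hx hz) hxz
  have hyz'' := mt (ne hy hz) hyz
  have hadd_zero : x + a = 0 ∨ y + a = 0 ∨ z + a = 0 := by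
    simp only [← quadraticChar_eq_zero_iff]
    have := quadraticChar_trichotomy (x + a)
    have := quadraticChar_trichotomy (y + a)
    have := quadraticChar_trichotomy (z + a)
    omega
  have hzero : x = 0 ∨ y = 0 ∨ z = 0 := by
    simp only [← quadraticChar_eq_zero_iff]
    have := quadraticChar_trichotomy x
    have := quadraticChar_trichotomy y
    have := quadraticChar_trichotomy z
    omega
  -- Both `0` and `-a` are solutions, which forces `a = 0` and then `b = 0`.
  have sol_zero : (quadraticChar K a : K) * a = b := by
    rcases hzero with rfl | rfl | rfl
    · simpa using hx
    · simpa using hy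
    · simpa using hz
  have sol_neg : c * ((quadraticChar K a : K) * a) = b := by
    have of_add {u : K} (hu : (quadraticChar K (u + a) : K) * (u + a)
        - c * (quadraticChar K u * u) = b) (h0 : u + a = 0) :
        c * ((quadraticChar K a : K) * a) = b := by
      obtain rfl := eq_neg_of_add_eq_zero_left h0
      simpa [quadraticChar_neg_eq hneg] using hu
    exact hadd_zero.elim (of_add hx) (Or.rec (of_add hy) (of_add hz))
  have ha : a = 0 := by
    have hmul : (1 - c) * ((quadraticChar K a : K) * a) = 0 := by
      linear_combination sol_zero - sol_neg
    rcases quadraticChar_trichotomy a with h | h | h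
    · exact quadraticChar_eq_zero_iff.mp h
    all_goals simpa [h, h1] using hmul
  subst ha
  have eq_zero {u : K} (hu : (quadraticChar K (u + 0) : K) * (u + 0)
      - c * (quadraticChar K u * u) = b) : u = 0 := by
    have hmul : (1 - c) * ((quadraticChar K u : K) * u) = 0 := by
      rw [add_zero] at hu
      simp only [mul_zero] at sol_zero
      linear_combination hu - sol_zero
    rcases quadraticChar_trichotomy u with h | h | h
    · exact quadraticChar_eq_zero_iff.mp h
    all_goals simpa [h, h1] using hmul
  exact hxy ((eq_zero hx).trans (eq_zero hy).symm)

end SignedIdentity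

theorem stmt_10 (p n : ℕ) [Fact p.Prime] (hodd : Odd p) (hn : 0 < n)
    (hmod : p ^ n % 4 = 1)
    (c : GaloisField p n) (hc1 : c ≠ 1) (hc2 : c ≠ -1)
    (hsq : ∃ y : GaloisField p n, y ≠ 0 ∧ y ^ 2 = (1 - c) / (1 + c)) :
    cDiffUniformity (fun x : GaloisField p n => x ^ ((p ^ n + 1) / 2)) c ≤ 2 := by
  let _ : Fintype (GaloisField p n) := Fintype.ofFinite _
  have hcard : Fintype.card (GaloisField p n) = p ^ n := by
    rw [← Nat.card_eq_fintype_card, GaloisField.card p n hn.ne']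
  have hchar : ringChar (GaloisField p n) ≠ 2 := by
    rw [ringChar.eq (GaloisField p n) p]
    rintro rfl
    exact absurd hodd (by decide)
  have h1 : 1 - c ≠ 0 := sub_ne_zero.mpr hc1.symm
  have h2 : 1 + c ≠ 0 := fun h => hc2 (by linear_combination h)
  have hneg : quadraticChar (GaloisField p n) (-1) = 1 := by
    rw [quadraticChar_one_iff_isSquare (neg_ne_zero.mpr one_ne_zero),
      FiniteField.isSquare_neg_one_iff, hcard, hmod]
    decide
  have hc : quadraticChar (GaloisField p n) (1 - c) = quadraticChar _ (1 + c) := by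
    obtain ⟨y, hy, hyc⟩ := hsq
    rw [← div_mul_cancel₀ (1 - c) h2, ← hyc, map_mul, quadraticChar_sq_one' hy, one_mul]
  have hpow : (fun x : GaloisField p n => x ^ ((p ^ n + 1) / 2)) =
      fun x => (quadraticChar (GaloisField p n) x : GaloisField p n) * x := by
    funext x
    rw [quadraticChar_eq_pow_of_char_ne_two' hchar, hcard, ← pow_succ]
    congr 1
    omega
  rw [hpow]
  exact Finset.sup_le fun ab _ => deltaCount_signed_identity_le_two hneg hc h1 h2
end

section
/- Let n ≥ 2 be an even integer and G : GF(3^n) → GF(3^n) the power function G(x) = x^{(3^n+3)/2}. Then G is APcN for c = −1, i.e., the (−1)-differential uniformity of G equals 2. -/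
open scoped Classical

lemma deltaCount_eq_ncard {F : Type*} [Field F] [Finite F] (f : F → F) (c a b : F) :
    deltaCount f c a b = Set.ncard {x : F | f (x + a) - c * f x = b} :=
  rfl

section CharThree

variable {F : Type*} [Field F]

/-- The map `x ↦ χ(x) x²`, where `χ` is the quadratic character. -/
noncomputable def signedSq (x : F) : F := if IsSquare x then x ^ 2 else -x ^ 2

lemma eq_or_eq_neg_of_signedSq_eq {i : F} (hi : i ^ 2 = -1) (hsi : IsSquare i) {x y : F}
    (h : signedSq x = signedSq y) : x = y ∨ x = -y := by
  have hneg : IsSquare (-1 : F) := hi ▸ IsSquare.sq i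
  have key : ∀ u v : F, u ^ 2 = -v ^ 2 → IsSquare v → IsSquare u := by
    intro u v huv hv
    have hs : u ^ 2 = (i * v) ^ 2 := by linear_combination huv - v ^ 2 * hi
    rcases sq_eq_sq_iff_eq_or_eq_neg.mp hs with rfl | rfl
    · exact hsi.mul hv
    · simpa using hneg.mul (hsi.mul hv)
  rw [← sq_eq_sq_iff_eq_or_eq_neg]
  unfold signedSq at h
  split_ifs at h with a b b
  · exact h
  · exact absurd (key y x (by linear_combination h) a) b
  · exact absurd (key x y (by linear_combination -h) b) a
  · linear_combination -h

lemma isSquare_add_one_of_sq_add_sq_eq_one (h3 : (3 : F) = 0) {i : F} (hi : i ^ 2 = -1)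
    (hsi : IsSquare i) {y z : F} (hyz : y ^ 2 + z ^ 2 = 1) (h1 : IsSquare (y + 1))
    (h2 : IsSquare (y - 1)) : IsSquare (z + 1) := by
  obtain ⟨t, ht⟩ : ∃ t, t = y + i * z := ⟨_, rfl⟩
  obtain ⟨u, hu⟩ : ∃ u, u = y - i * z := ⟨_, rfl⟩
  have htu : t * u = 1 := by
    subst ht hu
    linear_combination hyz - z ^ 2 * hi
  have hsu : IsSquare u := by
    by_cases h : t + 1 = 0
    · have hu1 : u + 1 = 0 := by linear_combination u * h - htu
      have hy : y - 2 = 0 := by linear_combination y * h3 + ht + hu - h - hu1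
      have e : u = i ^ 2 * (y - 1) := by linear_combination hu1 - (y - 1) * hi + hy
      rw [e]
      exact (IsSquare.sq i).mul h2
    · have e : u = (i / (t + 1)) ^ 2 * (y + 1) := by
        field_simp
        linear_combination (t + 2) * htu - (y + 1) * hi + ht + hu + (y + 1) * h3
      rw [e]
      exact (IsSquare.sq _).mul h1
  have e : z + 1 = i * (t + i) ^ 2 * u := by
    linear_combination -i * (t + 2 * i) * htu - i * u * hi - i * (ht - hu) - 2 * (z + 1) * hi
      + (z + 1) * h3
  rw [e]
  exact (hsi.mul (IsSquare.sq _)).mul hsu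

lemma isSquare_add_sub_one_of_sq_add_one_eq (h3 : (3 : F) = 0) (hneg : IsSquare (-1 : F))
    {y z : F} (hs : IsSquare ((y + 1) * (y - 1))) (h : y ^ 2 + 1 = z ∨ y ^ 2 + 1 = -z) :
    IsSquare (z + 1) ∧ IsSquare (z - 1) := by
  rcases h with h | h
  · have e₁ : z + 1 = (y + 1) * (y - 1) := by linear_combination -h + h3
    have e₂ : z - 1 = y ^ 2 := by linear_combination -h
    exact ⟨e₁ ▸ hs, e₂ ▸ IsSquare.sq y⟩
  · have e₁ : z + 1 = -1 * y ^ 2 := by linear_combination h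
    have e₂ : z - 1 = -1 * ((y + 1) * (y - 1)) := by linear_combination h - h3
    exact ⟨e₁ ▸ hneg.mul (IsSquare.sq y), e₂ ▸ hneg.mul hs⟩

lemma eq_or_eq_neg_of_signedSq_add_eq (h3 : (3 : F) = 0) {i : F} (hi : i ^ 2 = -1)
    (hsi : IsSquare i) (hmul : ∀ x y : F, ¬IsSquare x → ¬IsSquare y → IsSquare (x * y))
    {y z : F}
    (h : signedSq (y - 1) + signedSq (y + 1) = signedSq (z - 1) + signedSq (z + 1)) :
    y = z ∨ y = -z := by
  have hneg : IsSquare (-1 : F) := hi ▸ IsSquare.sq i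
  have L₁ := fun y z => @isSquare_add_sub_one_of_sq_add_one_eq F _ h3 hneg y z
  have L₂ := fun y z => @isSquare_add_one_of_sq_add_sq_eq_one F _ h3 i hi hsi y z
  unfold signedSq at h
  by_cases a : IsSquare (y - 1) <;> by_cases b : IsSquare (y + 1) <;>
    by_cases c : IsSquare (z - 1) <;> by_cases d : IsSquare (z + 1) <;>
    simp only [if_pos, if_neg, a, b, c, d, not_false_eq_true] at h
  · exact sq_eq_sq_iff_eq_or_eq_neg.mp (by linear_combination -h + (y ^ 2 - z ^ 2) * h3)
  · exact absurd (L₁ y z (b.mul a)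
      (.inl (by linear_combination -h + (y ^ 2 + 1 + z) * h3))).1 d
  · exact absurd (L₁ y z (b.mul a)
      (.inr (by linear_combination -h + (y ^ 2 + 1 - z) * h3))).2 c
  · exact absurd (L₂ y z (by linear_combination -h + (y ^ 2 + z ^ 2 + 1) * h3) b a) d
  · exact absurd (L₁ z y (d.mul c)
      (.inl (by linear_combination h + (z ^ 2 + 1 + y) * h3))).1 b
  · exact .inl (by linear_combination -h - (y - z) * h3)
  · exact .inr (by linear_combination -h - (y + z) * h3)
  · exact absurd (L₁ z y (hmul _ _ d c)
      (.inr (by linear_combination -h + (z ^ 2 + 1 - y) * h3))).1 b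
  · exact absurd (L₁ z y (d.mul c)
      (.inr (by linear_combination h + (z ^ 2 + 1 - y) * h3))).2 a
  · exact .inr (by linear_combination h - (y + z) * h3)
  · exact .inl (by linear_combination h - (y - z) * h3)
  · exact absurd (L₁ z y (hmul _ _ d c)
      (.inl (by linear_combination -h + (z ^ 2 + 1 + y) * h3))).2 a
  · exact absurd (L₂ z y (by linear_combination h + (y ^ 2 + z ^ 2 + 1) * h3) d c) b
  · exact absurd (L₁ y z (hmul _ _ b a)
      (.inr (by linear_combination h + (y ^ 2 + 1 - z) * h3))).1 d
  · exact absurd (L₁ y z (hmul _ _ b a)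
      (.inl (by linear_combination h + (y ^ 2 + 1 + z) * h3))).2 c
  · exact sq_eq_sq_iff_eq_or_eq_neg.mp (by linear_combination h + (y ^ 2 - z ^ 2) * h3)

/-- A multiplicative form of `signedSq` takes each value of `x ↦ f (x + a) + f x` on at most one
orbit of the involution `x ↦ -a - x`. -/
lemma eq_or_eq_neg_sub_of_pow_add_eq (h3 : (3 : F) = 0) {i : F} (hi : i ^ 2 = -1)
    (hsi : IsSquare i) (hmul : ∀ x y : F, ¬IsSquare x → ¬IsSquare y → IsSquare (x * y))
    {d : ℕ} (hd : ∀ x : F, x ^ d = signedSq x) {a x y : F}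
    (h : (x + a) ^ d + x ^ d = (y + a) ^ d + y ^ d) : x = y ∨ x = -a - y := by
  by_cases ha : a = 0
  · subst ha
    have hxy : x ^ d = y ^ d := by
      simp only [add_zero] at h
      linear_combination -h + (x ^ d - y ^ d) * h3
    rw [hd, hd] at hxy
    simpa using eq_or_eq_neg_of_signedSq_eq hi hsi hxy
  · have e₁ : ∀ x : F, x + a = a * ((x / a - 1) - 1) := by
      intro x
      field_simp
      linear_combination a * h3
    have e₂ : ∀ x : F, x = a * ((x / a - 1) + 1) := by
      intro x
      field_simp
      ring
    have hs : ∀ x : F, (x + a) ^ d + x ^ d =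
        a ^ d * (signedSq ((x / a - 1) - 1) + signedSq ((x / a - 1) + 1)) := by
      intro x
      rw [← hd, ← hd, mul_add, ← mul_pow, ← mul_pow, ← e₁, ← e₂]
    rw [hs, hs] at h
    rcases eq_or_eq_neg_of_signedSq_add_eq h3 hi hsi hmul
      (mul_left_cancel₀ (pow_ne_zero d ha) h) with h | h
    · left
      field_simp at h
      linear_combination h
    · right
      field_simp at h
      linear_combination h + a * h3

end CharThree

lemma isSquare_mul_of_not_isSquare {F : Type*} [Field F] [Fintype F] (hF : ringChar F ≠ 2)
    {x y : F} (hx : ¬IsSquare x) (hy : ¬IsSquare y) : IsSquare (x * y) := by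
  have key : ∀ u : F, ¬IsSquare u → u ≠ 0 ∧ u ^ (Fintype.card F / 2) = -1 := by
    intro u hu
    have h0 : u ≠ 0 := by
      rintro rfl
      exact hu IsSquare.zero
    exact ⟨h0, (FiniteField.pow_dichotomy hF h0).resolve_left
      (mt (FiniteField.isSquare_iff hF h0).mpr hu)⟩
  obtain ⟨hx0, hx⟩ := key x hx
  obtain ⟨hy0, hy⟩ := key y hy
  rw [FiniteField.isSquare_iff hF (mul_ne_zero hx0 hy0), mul_pow, hx, hy]
  ring

lemma pow_eq_signedSq {F : Type*} [Field F] [Fintype F] (hF : ringChar F ≠ 2) (x : F) :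
    x ^ (Fintype.card F / 2 + 2) = signedSq x := by
  unfold signedSq
  by_cases h0 : x = 0
  · simp [h0]
  rw [pow_add]
  split_ifs with h
  · rw [(FiniteField.isSquare_iff hF h0).mp h, one_mul]
  · rw [(FiniteField.pow_dichotomy hF h0).resolve_left
      (mt (FiniteField.isSquare_iff hF h0).mpr h), neg_one_mul]

lemma exists_sq_eq_neg_one_and_isSquare {F : Type*} [Field F] [Fintype F]
    (hF : ringChar F ≠ 2) (hq : Fintype.card F % 8 = 1) :
    ∃ i : F, i ^ 2 = -1 ∧ IsSquare i := by
  obtain ⟨i, hi⟩ := FiniteField.isSquare_neg_one_iff.mpr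
    (show Fintype.card F % 4 ≠ 3 by omega)
  have hi' : i ^ 2 = -1 := by rw [hi, sq]
  have h0 : i ≠ 0 := by
    rintro rfl
    simp at hi
  refine ⟨i, hi', (FiniteField.isSquare_iff hF h0).mpr ?_⟩
  obtain ⟨k, hk⟩ : ∃ k, Fintype.card F / 2 = 2 * (2 * k) :=
    ⟨Fintype.card F / 8, by omega⟩
  rw [hk, pow_mul, hi', pow_mul]
  simp

theorem stmt_11 (n : ℕ) (hn : 2 ≤ n) (hne : Even n) :
    cDiffUniformity
        (fun x : GaloisField 3 n => x ^ ((3 ^ n + 3) / 2)) (-1 : GaloisField 3 n) = 2 := by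
  classical
  let : Fintype (GaloisField 3 n) := Fintype.ofFinite _
  have hcard : Fintype.card (GaloisField 3 n) = 3 ^ n := by
    rw [← Nat.card_eq_fintype_card, GaloisField.card 3 n (by omega)]
  have hF : ringChar (GaloisField 3 n) ≠ 2 := by
    rw [ringChar.eq (GaloisField 3 n) 3]
    decide
  have h3 : (3 : GaloisField 3 n) = 0 := by
    exact_mod_cast CharP.cast_eq_zero (GaloisField 3 n) 3
  have hq : 3 ^ n % 8 = 1 := by
    obtain ⟨m, rfl⟩ := hne
    rw [← two_mul, pow_mul, Nat.pow_mod]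
    simp
  obtain ⟨i, hi, hsi⟩ := exists_sq_eq_neg_one_and_isSquare hF (hcard ▸ hq)
  have hd : ∀ x : GaloisField 3 n, x ^ ((3 ^ n + 3) / 2) = signedSq x := by
    intro x
    rw [← pow_eq_signedSq hF, hcard]
    congr 1
    omega
  have hone : (1 : GaloisField 3 n) ≠ -1 := by
    intro h
    exact one_ne_zero (α := GaloisField 3 n) (by linear_combination h3 - h)
  apply le_antisymm
  · refine Finset.sup_le fun ab _ => ?_
    obtain ⟨a, b⟩ := ab
    rw [deltaCount_eq_ncard]
    by_cases hne : ∃ y : GaloisField 3 n,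
        (y + a) ^ ((3 ^ n + 3) / 2) - -1 * y ^ ((3 ^ n + 3) / 2) = b
    · obtain ⟨y, hy⟩ := hne
      refine (Set.ncard_le_ncard (t := {y, -a - y}) ?_ (Set.toFinite _)).trans
        ((Set.ncard_insert_le _ _).trans (by rw [Set.ncard_singleton]))
      intro x hx
      refine eq_or_eq_neg_sub_of_pow_add_eq h3 hi hsi
        (fun _ _ => isSquare_mul_of_not_isSquare hF) hd ?_
      replace hx : (x + a) ^ ((3 ^ n + 3) / 2) - -1 * x ^ ((3 ^ n + 3) / 2) = b := hx
      linear_combination hx - hy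
    · refine (Set.ncard_eq_zero (Set.toFinite _)).mpr
        (Set.eq_empty_of_forall_notMem fun x hx => hne ⟨x, hx⟩) |>.trans_le (Nat.zero_le 2)
  · have hle : 2 ≤ deltaCount (fun x : GaloisField 3 n => x ^ ((3 ^ n + 3) / 2)) (-1) 0 2 := by
      rw [deltaCount_eq_ncard]
      refine (Set.ncard_pair hone).symm.le.trans (Set.ncard_le_ncard ?_ (Set.toFinite _))
      have hneg : IsSquare (-1 : GaloisField 3 n) := hi ▸ IsSquare.sq i
      rintro x (rfl | rfl)
      · simp only [Set.mem_ofPred_eq, hd, signedSq, add_zero, IsSquare.one, if_true]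
        ring
      · simp only [Set.mem_ofPred_eq, hd, signedSq, add_zero, hneg, if_true]
        ring
    refine hle.trans ?_
    unfold cDiffUniformity
    refine Finset.le_sup (f := fun ab : GaloisField 3 n × GaloisField 3 n =>
      deltaCount (fun x : GaloisField 3 n => x ^ ((3 ^ n + 3) / 2)) (-1) ab.1 ab.2)
      (b := ((0 : GaloisField 3 n), (2 : GaloisField 3 n))) ?_
    simp [hone.symm]
end

section
/- Let p > 3 be an odd prime, n a positive integer with p^n ≡ 3 (mod 4), and F : GF(p^n) → GF(p^n) the power function F(x) = x^d with d = (p^n + 3)/2. Then the (−1)-differential uniformity of F is at most 3. -/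
open scoped Classical

section PowerFunction

variable {F : Type*} [Field F] [Fintype F]

theorem ringChar_ne_two_of_card_mod_four_eq_three (hF : Fintype.card F % 4 = 3) :
    ringChar F ≠ 2 := by
  intro h
  have := FiniteField.even_card_iff_char_two.mp h
  omega

theorem pow_card_add_three_div_two_of_isSquare (hF : Fintype.card F % 4 = 3) {x : F}
    (hx : IsSquare x) : x ^ ((Fintype.card F + 3) / 2) = x ^ 2 := by
  have hd : (Fintype.card F + 3) / 2 = Fintype.card F / 2 + 2 := by omega
  rcases eq_or_ne x 0 with rfl | h0
  · rw [zero_pow (by omega), zero_pow (by omega)]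
  · rw [hd, pow_add,
      (FiniteField.isSquare_iff (ringChar_ne_two_of_card_mod_four_eq_three hF) h0).mp hx, one_mul]

theorem pow_card_add_three_div_two_of_not_isSquare (hF : Fintype.card F % 4 = 3) {x : F}
    (hx : ¬ IsSquare x) : x ^ ((Fintype.card F + 3) / 2) = -x ^ 2 := by
  have hd : (Fintype.card F + 3) / 2 = Fintype.card F / 2 + 2 := by omega
  have h2 := ringChar_ne_two_of_card_mod_four_eq_three hF
  have h0 : x ≠ 0 := by
    rintro rfl
    exact hx IsSquare.zero
  rcases FiniteField.pow_dichotomy h2 h0 with h | h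
  · exact absurd ((FiniteField.isSquare_iff h2 h0).mpr h) hx
  · rw [hd, pow_add, h, neg_one_mul]

theorem isSquare_neg_of_not_isSquare (hF : Fintype.card F % 4 = 3) {x : F}
    (hx : ¬ IsSquare x) : IsSquare (-x) := by
  have h2 := ringChar_ne_two_of_card_mod_four_eq_three hF
  have h0 : x ≠ 0 := by
    rintro rfl
    exact hx IsSquare.zero
  have hodd : Odd (Fintype.card F / 2) := Nat.odd_iff.mpr (by omega)
  rw [FiniteField.isSquare_iff h2 (neg_ne_zero.mpr h0), hodd.neg_pow]
  rcases FiniteField.pow_dichotomy h2 h0 with h | h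
  · exact absurd ((FiniteField.isSquare_iff h2 h0).mpr h) hx
  · rw [h, neg_neg]

theorem eq_zero_of_isSquare_of_isSquare_neg (hF : Fintype.card F % 4 = 3) {x : F}
    (hx : IsSquare x) (hx' : IsSquare (-x)) : x = 0 := by
  by_contra h0
  have h : IsSquare (-1 : F) := by
    have := hx'.div hx
    rwa [neg_div, div_self h0] at this
  exact FiniteField.isSquare_neg_one_iff.mp h hF

theorem eq_or_add_eq_neg_of_sq_add_sq_eq (hF : Fintype.card F % 4 = 3) {a x y : F}
    (h : (x + a) ^ 2 + x ^ 2 = (y + a) ^ 2 + y ^ 2) : x = y ∨ x + a = -y := by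
  have h2 : (2 : F) ≠ 0 := Ring.two_ne_zero (ringChar_ne_two_of_card_mod_four_eq_three hF)
  have : 2 * ((x - y) * (x + a + y)) = 0 := by linear_combination h
  rcases mul_eq_zero.mp ((mul_eq_zero.mp this).resolve_left h2) with h | h
  · exact Or.inl (sub_eq_zero.mp h)
  · exact Or.inr (eq_neg_of_add_eq_zero_left h)

theorem deltaCount_neg_one_pow_le_three (hF : Fintype.card F % 4 = 3) (a b : F) :
    deltaCount (fun x : F => x ^ ((Fintype.card F + 3) / 2)) (-1) a b ≤ 3 := by
  have h2 : (2 : F) ≠ 0 := Ring.two_ne_zero (ringChar_ne_two_of_card_mod_four_eq_three hF)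
  have hs := fun x : F => pow_card_add_three_div_two_of_isSquare hF (x := x)
  have hn := fun x : F => pow_card_add_three_div_two_of_not_isSquare hF (x := x)
  have hneg := fun x : F => isSquare_neg_of_not_isSquare hF (x := x)
  have hzero := fun x : F => eq_zero_of_isSquare_of_isSquare_neg hF (x := x)
  have hmixed : ∀ x y : F, IsSquare (x + a) → ¬ IsSquare x → IsSquare y → ¬ IsSquare (y + a) →
      (x + a) ^ 2 - x ^ 2 ≠ y ^ 2 - (y + a) ^ 2 := by
    intro x y hxa hx hy hya h
    have ha : a ≠ 0 := by
      rintro rfl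
      exact hx (by simpa using hxa)
    have : 2 * (a * (x + (y + a))) = 0 := by linear_combination h
    have h' := (mul_eq_zero.mp ((mul_eq_zero.mp this).resolve_left h2)).resolve_left ha
    apply hya
    rw [eq_neg_of_add_eq_zero_right h']
    exact hneg x hx
  have hlinear : ∀ x y : F, IsSquare (x + a) → ¬ IsSquare x →
      (x + a) ^ 2 - x ^ 2 = (y + a) ^ 2 - y ^ 2 → x = y := by
    intro x y hxa hx h
    have ha : a ≠ 0 := by
      rintro rfl
      exact hx (by simpa using hxa)
    have : 2 * (a * (x - y)) = 0 := by linear_combination h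
    exact sub_eq_zero.mp
      ((mul_eq_zero.mp ((mul_eq_zero.mp this).resolve_left h2)).resolve_left ha)
  have hlinear' : ∀ x y : F, ¬ IsSquare (x + a) → IsSquare x →
      (x + a) ^ 2 - x ^ 2 = (y + a) ^ 2 - y ^ 2 → x = y := by
    intro x y hxa hx h
    have ha : a ≠ 0 := by
      rintro rfl
      exact hxa (by simpa using hx)
    have : 2 * (a * (x - y)) = 0 := by linear_combination h
    exact sub_eq_zero.mp
      ((mul_eq_zero.mp ((mul_eq_zero.mp this).resolve_left h2)).resolve_left ha)
  let g : F → Fin 3 := fun x =>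
    if IsSquare (x + a) then (if IsSquare x then 0 else 2) else (if IsSquare x then 2 else 1)
  have hg : Function.Injective fun x : {x : F // (fun x : F => x ^ ((Fintype.card F + 3) / 2))
      (x + a) - -1 * (fun x : F => x ^ ((Fintype.card F + 3) / 2)) x = b} => g x := by
    rintro ⟨x, hx⟩ ⟨y, hy⟩ hxy
    rw [Subtype.mk.injEq]
    have e := hx.trans hy.symm
    change g x = g y at hxy
    clear hx hy
    by_cases sx : IsSquare x <;> by_cases sxa : IsSquare (x + a) <;>
      by_cases sy : IsSquare y <;> by_cases sya : IsSquare (y + a) <;>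
      simp [g, sx, sxa, sy, sya] at hxy <;>
      simp only [hs, hn, sx, sxa, sy, sya, not_false_eq_true] at e
    · have hsq : (x + a) ^ 2 + x ^ 2 = (y + a) ^ 2 + y ^ 2 := by linear_combination e
      rcases eq_or_add_eq_neg_of_sq_add_sq_eq hF hsq with h | h
      · exact h
      · have hy0 := hzero y sy (h ▸ sxa)
        have hx0 := hzero x sx (by rwa [show -x = y + a by linear_combination -h])
        rw [hx0, hy0]
    · exact hlinear' x y sxa sx (by linear_combination -e)
    · exact absurd (by linear_combination -e) (hmixed y x sya sy sx sxa)
    · exact absurd (by linear_combination e) (hmixed x y sxa sx sy sya)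
    · exact hlinear x y sxa sx (by linear_combination e)
    · have hsq : (x + a) ^ 2 + x ^ 2 = (y + a) ^ 2 + y ^ 2 := by linear_combination -e
      rcases eq_or_add_eq_neg_of_sq_add_sq_eq hF hsq with h | h
      · exact h
      · exact absurd (h ▸ hneg y sy) sxa
  simpa [deltaCount] using Nat.card_le_card_of_injective _ hg

end PowerFunction

theorem stmt_13 (p n : ℕ) [Fact p.Prime] (hp : 3 < p) (hodd : Odd p) (hn : 0 < n)
    (hmod : p ^ n % 4 = 3) :
    cDiffUniformity
        (fun x : GaloisField p n => x ^ ((p ^ n + 3) / 2)) (-1 : GaloisField p n) ≤ 3 := by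
  let _ : Fintype (GaloisField p n) := Fintype.ofFinite _
  have hcard : Fintype.card (GaloisField p n) = p ^ n := by
    rw [← Nat.card_eq_fintype_card, GaloisField.card p n hn.ne']
  refine Finset.sup_le fun ab _ => ?_
  rw [← hcard] at hmod ⊢
  exact deltaCount_neg_one_pow_le_three hmod ab.1 ab.2
end

section
/- Let n ≥ 2 and F : GF(3^n) → GF(3^n) the power function F(x) = x^{3^n − 3}. Then the 0-differential uniformity of F equals 2, i.e., F is APcN for c = 0. -/
open scoped Classical

theorem FiniteField.sq_mul_pow_card_sub_three {K : Type*} [Field K] [Finite K]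
    (hK : 3 < Nat.card K) {x : K} (hx : x ≠ 0) : x ^ 2 * x ^ (Nat.card K - 3) = 1 := by
  have := Fintype.ofFinite K
  rw [Nat.card_eq_fintype_card] at hK ⊢
  rw [← pow_add, ← FiniteField.pow_card_sub_one_eq_one x hx]
  congr 1
  omega

theorem FiniteField.eq_or_eq_neg_of_pow_card_sub_three_eq {K : Type*} [Field K] [Finite K]
    (hK : 3 < Nat.card K) {x y : K} (h : x ^ (Nat.card K - 3) = y ^ (Nat.card K - 3)) :
    x = y ∨ x = -y := by
  have hne : Nat.card K - 3 ≠ 0 := by omega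
  by_cases hx : x = 0
  · subst hx
    rw [zero_pow hne] at h
    exact .inl (pow_eq_zero_iff hne |>.1 h.symm).symm
  have hy : y ≠ 0 := by
    rintro rfl
    rw [zero_pow hne] at h
    exact hx (pow_eq_zero_iff hne |>.1 h)
  have hx' := sq_mul_pow_card_sub_three hK hx
  have hy' := sq_mul_pow_card_sub_three hK hy
  rw [← h, ← hx'] at hy'
  exact sq_eq_sq_iff_eq_or_eq_neg.1 (mul_right_cancel₀ (pow_ne_zero _ hx) hy').symm

theorem cDiffUniformity_zero_pow_card_sub_three {K : Type*} [Field K] [Finite K]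
    (hK : 3 < Nat.card K) (hneg : (1 : K) ≠ -1) :
    cDiffUniformity (fun x : K => x ^ (Nat.card K - 3)) 0 = 2 := by
  unfold cDiffUniformity deltaCount
  apply le_antisymm
  · refine Finset.sup_le fun ⟨a, b⟩ _ => ?_
    simp only [zero_mul, sub_zero]
    change Set.ncard {x : K | (x + a) ^ (Nat.card K - 3) = b} ≤ 2
    rcases Set.eq_empty_or_nonempty {x : K | (x + a) ^ (Nat.card K - 3) = b} with h | ⟨y, hy⟩
    · simp [h]
    · refine (Set.ncard_le_ncard (t := {y, -(y + a) - a}) ?_ (Set.toFinite _)).trans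
        ((Set.ncard_insert_le _ _).trans (by simp))
      intro x hx
      rcases FiniteField.eq_or_eq_neg_of_pow_card_sub_three_eq hK
        (Eq.trans hx (Eq.symm hy)) with h | h
      · exact .inl (add_right_cancel h)
      · exact .inr (eq_sub_of_add_eq h)
  · refine le_trans ?_ (Finset.le_sup (b := ((0 : K), (1 : K))) (by simp))
    simp only [zero_mul, sub_zero, add_zero]
    change 2 ≤ Set.ncard {x : K | x ^ (Nat.card K - 3) = 1}
    rw [← Set.ncard_pair hneg]
    refine Set.ncard_le_ncard ?_ (Set.toFinite _)
    rintro x (rfl | rfl)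
    · simp
    · simpa using FiniteField.sq_mul_pow_card_sub_three hK (neg_ne_zero.2 (one_ne_zero (α := K)))

theorem stmt_15 (n : ℕ) (hn : 2 ≤ n) :
    cDiffUniformity
        (fun x : GaloisField 3 n => x ^ (3 ^ n - 3)) (0 : GaloisField 3 n) = 2 := by
  have hcard : Nat.card (GaloisField 3 n) = 3 ^ n := GaloisField.card 3 n (by omega)
  have hlt : 3 < 3 ^ n := by
    simpa using Nat.pow_lt_pow_right (a := 3) (by norm_num) (show 1 < n by omega)
  have hneg : (1 : GaloisField 3 n) ≠ -1 :=
    (Ring.neg_one_ne_one_of_char_ne_two (by rw [ringChar.eq (GaloisField 3 n) 3]; norm_num)).symm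
  have h := cDiffUniformity_zero_pow_card_sub_three (hcard ▸ hlt) hneg
  rwa [hcard] at h
end

section
/- Let n ≥ 2 and F : GF(3^n) → GF(3^n) the power function F(x) = x^{3^n − 3}. For every c ∈ GF(3^n) with c ∉ {0, 1, −1}, the c-differential uniformity of F is at most 5. -/
open scoped Classical

open Polynomial in
/-- Clearing denominators in `(x + a)⁻² - c x⁻² = b` gives a nonzero quartic in `x`. -/
theorem exists_quartic_of_inv_sq_sub {F : Type*} [Field F] {c : F} (hc1 : c ≠ 1) (a b : F) :
    ∃ p : F[X], p ≠ 0 ∧ p.natDegree ≤ 4 ∧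
      ∀ x : F, x ≠ 0 → x + a ≠ 0 → ((x + a) ^ 2)⁻¹ - c * (x ^ 2)⁻¹ = b → p.IsRoot x := by
  refine ⟨C b * X ^ 4 + C (2 * a * b) * X ^ 3 + C (b * a ^ 2 - 1 + c) * X ^ 2
    + C (2 * a * c) * X + C (c * a ^ 2), fun h => ?_, by compute_degree, fun x hx hxa h => ?_⟩
  · have h4 := congrArg (coeff · 4) h
    have h2 := congrArg (coeff · 2) h
    simp only [coeff_add, coeff_C_mul, coeff_X_pow, coeff_X, coeff_C, coeff_zero] at h4 h2
    norm_num at h4 h2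
    subst h4
    exact hc1 (by linear_combination h2)
  · simp only [IsRoot.def, eval_add, eval_mul, eval_C, eval_pow, eval_X]
    field_simp at h
    linear_combination -h

/-- For `f x = x⁻²` (with `0⁻¹ = 0`), the number of solutions of
`f (x + a) - c f x = b` is at most `5`. -/
theorem deltaCount_inv_sq_le {F : Type*} [Field F] [Finite F] {f : F → F}
    (hf : ∀ x, f x = (x ^ 2)⁻¹) {c : F} (hc1 : c ≠ 1) (hc2 : c ≠ -1) (a b : F) :
    deltaCount f c a b ≤ 5 := by
  obtain ⟨p, hp0, hdeg, hroot⟩ := exists_quartic_of_inv_sq_sub hc1 a b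
  obtain ⟨t, ht⟩ : ∃ t : F, ∀ x : F, (x = 0 ∨ x + a = 0) → f (x + a) - c * f x = b → x = t := by
    by_cases ha : a = 0
    · exact ⟨0, fun x hx _ => by simpa [ha] using hx⟩
    by_cases hb : (a ^ 2)⁻¹ = b
    · refine ⟨0, fun x hx h => hx.resolve_right fun hxa => hc2 ?_⟩
      obtain rfl : x = -a := eq_neg_of_add_eq_zero_left hxa
      simp only [hf, hxa, ← hb] at h
      field_simp at h
      linear_combination -h
    · refine ⟨-a, fun x hx h => eq_neg_of_add_eq_zero_left (hx.resolve_left fun hx0 => hb ?_)⟩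
      simpa [hf, hx0] using h
  have hsub : {x : F | f (x + a) - c * f x = b} ⊆ (insert t p.roots.toFinset : Finset F) := by
    intro x hx
    simp only [Finset.coe_insert, Set.mem_insert_iff, Finset.mem_coe, Multiset.mem_toFinset]
    by_cases h : x = 0 ∨ x + a = 0
    · exact Or.inl (ht x h hx)
    · push Not at h
      refine Or.inr ((Polynomial.mem_roots hp0).2 (hroot x h.1 h.2 ?_))
      simpa only [hf, Set.mem_ofPred_eq] using hx
  calc deltaCount f c a b = {x : F | f (x + a) - c * f x = b}.ncard := rfl
    _ ≤ (insert t p.roots.toFinset : Finset F).card := by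
      rw [← Set.ncard_coe_finset]
      exact Set.ncard_le_ncard hsub (Finset.finite_toSet _)
    _ ≤ p.roots.toFinset.card + 1 := Finset.card_insert_le _ _
    _ ≤ 5 := by
      have := p.roots.toFinset_card_le
      have := p.card_roots'
      omega

theorem GaloisField.pow_three_pow_sub_three {n : ℕ} (hn : 2 ≤ n) (x : GaloisField 3 n) :
    x ^ (3 ^ n - 3) = (x ^ 2)⁻¹ := by
  have h9 : 3 ^ 2 ≤ 3 ^ n := Nat.pow_le_pow_right (by norm_num) hn
  rcases eq_or_ne x 0 with rfl | hx
  · rw [zero_pow (by omega)]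
    simp
  · let : Fintype (GaloisField 3 n) := Fintype.ofFinite _
    have hcard : Fintype.card (GaloisField 3 n) = 3 ^ n := by
      rw [← Nat.card_eq_fintype_card, GaloisField.card 3 n (by omega)]
    have h1 := FiniteField.pow_card_sub_one_eq_one x hx
    rw [hcard] at h1
    refine eq_inv_of_mul_eq_one_left ?_
    rw [← pow_add, ← h1]
    congr 1
    omega

theorem stmt_16 (n : ℕ) (hn : 2 ≤ n) (c : GaloisField 3 n)
    (hc0 : c ≠ 0) (hc1 : c ≠ 1) (hc2 : c ≠ -1) :
    cDiffUniformity (fun x : GaloisField 3 n => x ^ (3 ^ n - 3)) c ≤ 5 := by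
  unfold cDiffUniformity
  exact Finset.sup_le fun ab _ =>
    deltaCount_inv_sq_le (GaloisField.pow_three_pow_sub_three hn) hc1 hc2 ab.1 ab.2
end

section
/- Let p be an odd prime, n a positive integer, and F : GF(p^n) → GF(p^n) the power function F(x) = x^d with d = (p^n − 3)/2. Then the (−1)-differential uniformity of F is at most 4. -/
open scoped Classical

section QuadraticCharInverse

variable {K : Type*} [Field K] [Fintype K]

/-- The map `x ↦ χ(x) x⁻¹`, where `χ` is the quadratic character. -/
noncomputable def quadInv (x : K) : K := (quadraticChar K x : K) * x⁻¹

theorem pow_card_sub_three_div_two (hK : ringChar K ≠ 2) (h3 : 3 < Fintype.card K) (x : K) :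
    x ^ ((Fintype.card K - 3) / 2) = quadInv x := by
  have hodd : Fintype.card K % 2 = 1 := FiniteField.odd_card_of_char_ne_two hK
  rcases eq_or_ne x 0 with rfl | hx
  · have : (Fintype.card K - 3) / 2 ≠ 0 := by omega
    simp [quadInv, this]
  · rw [quadInv, quadraticChar_eq_pow_of_char_ne_two' hK, eq_mul_inv_iff_mul_eq₀ hx, ← pow_succ]
    congr 1
    omega

theorem quadInv_mul (x y : K) : quadInv (x * y) = quadInv x * quadInv y := by
  simp only [quadInv, map_mul, mul_inv, Int.cast_mul]
  ring

theorem quadInv_one : quadInv (1 : K) = 1 := by simp [quadInv]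

theorem quadInv_zero : quadInv (0 : K) = 0 := by simp [quadInv]

theorem quadInv_ne_zero {x : K} (hx : x ≠ 0) : quadInv x ≠ 0 := by
  rcases quadraticChar_dichotomy hx with h | h <;> simp [quadInv, h, hx]

/-- The solutions of `quadInv (x + 1) + quadInv x = c` with `χ(x + 1) = e` and `χ(x) = d`,
after clearing denominators. -/
noncomputable def signedSolutions (c : K) (e d : ℤ) : Finset K :=
  Finset.univ.filter fun x => quadraticChar K (x + 1) = e ∧ quadraticChar K x = d ∧
    (e : K) * x + d * (x + 1) = c * x * (x + 1)

/-- The solutions of `quadInv (x + 1) + quadInv x = c`. -/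
noncomputable def solutions (c : K) : Finset K :=
  Finset.univ.filter fun x => quadInv (x + 1) + quadInv x = c

theorem mem_signedSolutions {c x : K} {e d : ℤ} : x ∈ signedSolutions c e d ↔
    quadraticChar K (x + 1) = e ∧ quadraticChar K x = d ∧
    (e : K) * x + d * (x + 1) = c * x * (x + 1) := by
  simp [signedSolutions]

theorem mem_solutions_cases {c x : K} (hx : x ∈ solutions c) :
    (x = 0 ∧ c = 1) ∨ (x = -1 ∧ c = quadInv (-1)) ∨ x ∈ signedSolutions c 1 1 ∨
      x ∈ signedSolutions c (-1) (-1) ∨ x ∈ signedSolutions c 1 (-1) ∨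
      x ∈ signedSolutions c (-1) 1 := by
  simp only [solutions, Finset.mem_filter, Finset.mem_univ, true_and] at hx
  rcases eq_or_ne x 0 with rfl | h0
  · left; simpa [quadInv_zero, quadInv_one, eq_comm] using hx
  rcases eq_or_ne (x + 1) 0 with h1 | h1
  · obtain rfl : x = -1 := by linear_combination h1
    right; left; simpa [quadInv_zero, eq_comm] using hx
  have key : (quadraticChar K (x + 1) : K) * x + quadraticChar K x * (x + 1)
      = c * x * (x + 1) := by
    rw [← hx, quadInv, quadInv]; field_simp
  simp only [mem_signedSolutions]
  rcases quadraticChar_dichotomy h0 with h | h <;>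
  rcases quadraticChar_dichotomy h1 with h' | h' <;>
  · rw [h, h'] at key
    simp only [h, h', key, true_and, and_true, or_true, true_or, reduceCtorEq, false_and]

/-- Vieta's formulas for two distinct signed solutions. -/
theorem signedSolutions_vieta {c x y : K} {e d : ℤ} (hx : x ∈ signedSolutions c e d)
    (hy : y ∈ signedSolutions c e d) (hxy : x ≠ y) :
    c * (x + y + 1) = e + d ∧ c * (x * y) = -d ∧ c * ((x + 1) * (y + 1)) = e := by
  obtain ⟨-, -, h1⟩ := mem_signedSolutions.1 hx
  obtain ⟨-, -, h2⟩ := mem_signedSolutions.1 hy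
  have h3 : c * (x + y + 1) = e + d := by
    apply mul_left_cancel₀ (sub_ne_zero.2 hxy)
    linear_combination h2 - h1
  have h4 : c * (x * y) = -d := by linear_combination x * h3 + h1
  exact ⟨h3, h4, by linear_combination h3 + h4⟩

theorem card_signedSolutions_le_two {c : K} (hc : c ≠ 0) (e d : ℤ) :
    (signedSolutions c e d).card ≤ 2 := by
  by_contra! h
  obtain ⟨x, hx, y, hy, z, hz, hxy, hxz, hyz⟩ := Finset.two_lt_card.1 h
  have h1 := (signedSolutions_vieta hx hy hxy).1
  have h2 := (signedSolutions_vieta hx hz hxz).1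
  apply hyz
  apply mul_left_cancel₀ hc
  linear_combination h1 - h2

theorem quadraticChar_of_two_signedSolutions {c x y : K} {e d : ℤ} (he : e * e = 1)
    (hd : d * d = 1)
    (hx : x ∈ signedSolutions c e d) (hy : y ∈ signedSolutions c e d) (hxy : x ≠ y) :
    quadraticChar K c = quadraticChar K (-d) ∧ quadraticChar K c = quadraticChar K e := by
  obtain ⟨-, h1, h2⟩ := signedSolutions_vieta hx hy hxy
  obtain ⟨hx1, hx0, -⟩ := mem_signedSolutions.1 hx
  obtain ⟨hy1, hy0, -⟩ := mem_signedSolutions.1 hy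
  rw [← h1, ← h2]
  simp only [map_mul, hx1, hx0, hy1, hy0, he, hd, mul_one, and_self]

theorem card_signedSolutions_self_le_one {c : K} {e : ℤ} (he : e = 1 ∨ e = -1)
    (h : quadraticChar K (-1) = -1 ∨ quadraticChar K c ≠ 1) :
    (signedSolutions c e e).card ≤ 1 := by
  by_contra! hcard
  obtain ⟨x, hx, y, hy, hxy⟩ := Finset.one_lt_card.1 hcard
  obtain ⟨h1, h2⟩ := quadraticChar_of_two_signedSolutions
    (by rcases he with rfl | rfl <;> rfl) (by rcases he with rfl | rfl <;> rfl) hx hy hxy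
  rcases he with rfl | rfl <;> simp only [Int.cast_one, Int.cast_neg, neg_neg, map_one] at h1 h2 <;>
    rcases h with h | h <;>
    first | exact h h2 | exact h h1 | omega

theorem card_signedSolutions_neg_le_one {c : K} (hc : c ≠ 0) {e : ℤ} (he : e = 1 ∨ e = -1)
    (h : quadraticChar K (-1) = 1) : (signedSolutions c e (-e)).card ≤ 1 := by
  by_contra! hcard
  obtain ⟨x, hx, y, hy, hxy⟩ := Finset.one_lt_card.1 hcard
  obtain ⟨h1, -, -⟩ := signedSolutions_vieta hx hy hxy
  have h2 : y = -1 * (x + 1) := by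
    apply mul_left_cancel₀ hc
    push_cast at h1
    linear_combination h1
  have h3 := (mem_signedSolutions.1 hx).1
  have h4 := (mem_signedSolutions.1 hy).2.1
  rw [h2, map_mul, h, h3] at h4
  omega

theorem quadraticChar_of_mem_signedSolutions_neg {c x : K} {e : ℤ} (he : e = 1 ∨ e = -1)
    (hx : x ∈ signedSolutions c e (-e)) : quadraticChar K c = -quadraticChar K (-e) := by
  obtain ⟨h1, h2, h3⟩ := mem_signedSolutions.1 hx
  have h4 : (-e : K) = c * x * (x + 1) := by
    rw [← h3]; push_cast; ring
  rw [h4, map_mul, map_mul, h1, h2]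
  rcases he with rfl | rfl <;> ring

theorem card_solutions_le (c : K) : (solutions c).card ≤
    (if c = 1 then 1 else 0) + (if c = quadInv (-1) then 1 else 0) +
      (signedSolutions c 1 1).card + (signedSolutions c (-1) (-1)).card +
      (signedSolutions c 1 (-1)).card + (signedSolutions c (-1) 1).card := by
  have hsub : solutions c ⊆ (((((if c = 1 then {0} else ∅) ∪
      (if c = quadInv (-1) then {-1} else ∅)) ∪
      signedSolutions c 1 1) ∪ signedSolutions c (-1) (-1)) ∪ signedSolutions c 1 (-1)) ∪
      signedSolutions c (-1) 1 := by
    intro x hx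
    simp only [Finset.mem_union]
    rcases mem_solutions_cases hx with ⟨rfl, h⟩ | ⟨rfl, h⟩ | h | h | h | h
    · simp [h]
    · simp [← h]
    all_goals simp [h]
  have h1 : (if c = 1 then ({0} : Finset K) else ∅).card = if c = 1 then 1 else 0 := by
    split_ifs <;> simp
  have h2 : (if c = quadInv (-1) then ({-1} : Finset K) else ∅).card =
      if c = quadInv (-1) then 1 else 0 := by
    split_ifs <;> simp
  rw [← h1, ← h2]
  refine (Finset.card_le_card hsub).trans ?_
  refine (Finset.card_union_le _ _).trans (Nat.add_le_add_right ?_ _)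
  refine (Finset.card_union_le _ _).trans (Nat.add_le_add_right ?_ _)
  refine (Finset.card_union_le _ _).trans (Nat.add_le_add_right ?_ _)
  refine (Finset.card_union_le _ _).trans (Nat.add_le_add_right ?_ _)
  exact Finset.card_union_le _ _

theorem card_solutions_zero_le (hK : ringChar K ≠ 2) : (solutions (0 : K)).card ≤ 1 := by
  have h2 : (2 : K) ≠ 0 := Ring.two_ne_zero hK
  have key : ∀ x ∈ solutions (0 : K), 2 * x = -1 := by
    intro x hx
    rcases mem_solutions_cases hx with ⟨-, h⟩ | ⟨-, h⟩ | h | h | h | h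
    · exact absurd h zero_ne_one
    · exact absurd h.symm (quadInv_ne_zero (by simp))
    all_goals
      have h3 := (mem_signedSolutions.1 h).2.2
      push_cast at h3
    · linear_combination h3
    · linear_combination -h3
    · exact absurd (by linear_combination -h3) (one_ne_zero (α := K))
    · exact absurd (by linear_combination h3) (one_ne_zero (α := K))
  refine Finset.card_le_one.2 fun x hx y hy => mul_left_cancel₀ h2 ?_
  rw [key x hx, key y hy]

theorem quadraticChar_eq_one_of_sq {x y : K} (hy : y ≠ 0) (h : x = y ^ 2) :
    quadraticChar K x = 1 := by
  rw [h]; exact quadraticChar_sq_one' hy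

theorem ne_zero_of_quadraticChar_eq {x : K} {e : ℤ} (he : e ≠ 0)
    (h : quadraticChar K x = e) : x ≠ 0 := by
  rintro rfl
  simp at h
  exact he h.symm

theorem card_solutions_le_four_of_one (hK : ringChar K ≠ 2) {c : K} (hc : c ≠ 0)
    (h : quadraticChar K (-1) = 1) : (solutions c).card ≤ 4 := by
  have hne : (1 : K) ≠ -1 := (Ring.neg_one_ne_one_of_char_ne_two hK).symm
  have hq : quadInv (-1 : K) = -1 := by simp [quadInv, h, inv_neg]
  have hcard := card_solutions_le c
  rw [hq] at hcard
  rcases quadraticChar_dichotomy hc with h1 | h1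
  · have hpn : signedSolutions c 1 (-1) = ∅ := Finset.eq_empty_of_forall_notMem fun x hx => by
      have := quadraticChar_of_mem_signedSolutions_neg (Or.inl rfl) hx
      simp [h, h1] at this
    have hnp : signedSolutions c (-1) 1 = ∅ := Finset.eq_empty_of_forall_notMem fun x hx => by
      have := quadraticChar_of_mem_signedSolutions_neg (e := -1) (Or.inr rfl) hx
      simp [h1] at this
    have hpp := card_signedSolutions_le_two hc 1 1
    have hnn := card_signedSolutions_le_two hc (-1) (-1)
    rw [hpn, hnp, Finset.card_empty] at hcard
    by_cases hc1 : c = 1 ∨ c = -1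
    · have : signedSolutions c (-1) (-1) = ∅ := Finset.eq_empty_of_forall_notMem fun x hx => by
        obtain ⟨hx1, hx0, hx2⟩ := mem_signedSolutions.1 hx
        have hx1' := ne_zero_of_quadraticChar_eq (by decide) hx1
        have hx0' := ne_zero_of_quadraticChar_eq (by decide) hx0
        push_cast at hx2
        rcases hc1 with rfl | rfl
        · have : quadraticChar K (-1 * x) = 1 :=
            quadraticChar_eq_one_of_sq hx1' (by linear_combination hx2)
          rw [map_mul, h, hx0] at this
          omega
        · have := quadraticChar_eq_one_of_sq hx0' (show x + 1 = x ^ 2 by linear_combination -hx2)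
          omega
      rw [this, Finset.card_empty] at hcard
      rcases hc1 with rfl | rfl
      · rw [if_pos rfl, if_neg hne] at hcard; omega
      · rw [if_pos rfl, if_neg hne.symm] at hcard; omega
    · push Not at hc1
      rw [if_neg hc1.1, if_neg hc1.2] at hcard
      omega
  · have hc1 : c ≠ 1 := by rintro rfl; simp at h1
    have hc2 : c ≠ -1 := by rintro rfl; omega
    rw [if_neg hc1, if_neg hc2] at hcard
    have hpp := card_signedSolutions_self_le_one (c := c) (Or.inl rfl) (Or.inr (by omega))
    have hnn := card_signedSolutions_self_le_one (c := c) (e := -1) (Or.inr rfl)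
      (Or.inr (by omega))
    have hpn := card_signedSolutions_neg_le_one hc (Or.inl rfl) h
    have hnp := card_signedSolutions_neg_le_one hc (e := -1) (Or.inr rfl) h
    rw [neg_neg] at hnp
    omega

theorem card_solutions_le_four_of_neg_one {c : K} (hc : c ≠ 0)
    (h : quadraticChar K (-1) = -1) : (solutions c).card ≤ 4 := by
  have hq : quadInv (-1 : K) = 1 := by simp [quadInv, h, inv_neg]
  have hcard := card_solutions_le c
  rw [hq] at hcard
  have hpp := card_signedSolutions_self_le_one (c := c) (Or.inl rfl) (Or.inl h)
  have hnn := card_signedSolutions_self_le_one (c := c) (e := -1) (Or.inr rfl) (Or.inl h)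
  have hpn := card_signedSolutions_le_two hc 1 (-1)
  have hnp := card_signedSolutions_le_two hc (-1) 1
  rcases quadraticChar_dichotomy hc with h1 | h1
  · have hnp0 : signedSolutions c (-1) 1 = ∅ := Finset.eq_empty_of_forall_notMem fun x hx => by
      have := quadraticChar_of_mem_signedSolutions_neg (e := -1) (Or.inr rfl) hx
      simp [h1] at this
    rw [hnp0, Finset.card_empty] at hcard
    rcases eq_or_ne c 1 with rfl | hc1
    · have hpn0 : signedSolutions (1 : K) 1 (-1) = ∅ :=
        Finset.eq_empty_of_forall_notMem fun x hx => by
          obtain ⟨hx1, hx0, hx2⟩ := mem_signedSolutions.1 hx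
          have hx0' := ne_zero_of_quadraticChar_eq (by decide) hx0
          push_cast at hx2
          have : quadraticChar K (-1 * (x + 1)) = 1 :=
            quadraticChar_eq_one_of_sq hx0' (by linear_combination hx2)
          rw [map_mul, h, hx1] at this
          omega
      rw [hpn0, Finset.card_empty, if_pos rfl] at hcard
      omega
    · rw [if_neg hc1] at hcard
      omega
  · have hpn0 : signedSolutions c 1 (-1) = ∅ := Finset.eq_empty_of_forall_notMem fun x hx => by
      have := quadraticChar_of_mem_signedSolutions_neg (Or.inl rfl) hx
      simp [h, h1] at this
    have hc1 : c ≠ 1 := by rintro rfl; simp at h1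
    rw [hpn0, Finset.card_empty, if_neg hc1] at hcard
    omega

theorem card_solutions_le_four (hK : ringChar K ≠ 2) (c : K) : (solutions c).card ≤ 4 := by
  rcases eq_or_ne c 0 with rfl | hc
  · exact (card_solutions_zero_le hK).trans (by norm_num)
  rcases quadraticChar_dichotomy (F := K) (a := -1) (by simp) with h | h
  · exact card_solutions_le_four_of_one hK hc h
  · exact card_solutions_le_four_of_neg_one hc h

theorem card_quadInv_fiber_le (b : K) :
    (Finset.univ.filter fun x : K => quadInv x = b).card ≤ 2 := by
  have hsub : (Finset.univ.filter fun x : K => quadInv x = b) ⊆ {b⁻¹, -b⁻¹} := by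
    intro x hx
    obtain rfl : quadInv x = b := by simpa using hx
    rcases eq_or_ne x 0 with rfl | h0
    · simp [quadInv_zero]
    · rcases quadraticChar_dichotomy h0 with h | h <;> simp [quadInv, h]
  exact (Finset.card_le_card hsub).trans Finset.card_le_two

theorem deltaCount_quadInv_neg_one_le (hK : ringChar K ≠ 2) (a b : K) :
    deltaCount quadInv (-1) a b ≤ 4 := by
  have h2 : (2 : K) ≠ 0 := Ring.two_ne_zero hK
  rw [deltaCount, Nat.card_eq_fintype_card, Fintype.card_subtype]
  rcases eq_or_ne a 0 with rfl | ha
  · refine le_trans (Finset.card_le_card fun x hx => ?_)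
      ((card_quadInv_fiber_le (b / 2)).trans (by norm_num))
    simp only [Finset.mem_filter, Finset.mem_univ, true_and, add_zero] at hx ⊢
    rw [eq_div_iff h2]
    linear_combination hx
  · refine le_trans (Finset.card_le_card_of_injOn (fun x => x / a) ?_ ?_)
      (card_solutions_le_four hK (b / quadInv a))
    · intro x hx
      simp only [Finset.coe_filter, Finset.mem_univ, true_and, Set.mem_ofPred_eq, solutions] at hx ⊢
      rw [eq_div_iff (quadInv_ne_zero ha), add_mul, ← quadInv_mul, ← quadInv_mul, add_mul,
        div_mul_cancel₀ _ ha, one_mul]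
      linear_combination hx
    · intro x _ y _ hxy
      exact (div_left_inj' ha).1 hxy

end QuadraticCharInverse

theorem stmt_17 (p n : ℕ) [Fact p.Prime] (hodd : Odd p) (hn : 0 < n) :
    cDiffUniformity
        (fun x : GaloisField p n => x ^ ((p ^ n - 3) / 2)) (-1 : GaloisField p n) ≤ 4 := by
  let : Fintype (GaloisField p n) := Fintype.ofFinite _
  have hcard : Fintype.card (GaloisField p n) = p ^ n := by
    rw [← Nat.card_eq_fintype_card, GaloisField.card p n hn.ne']
  have hK : ringChar (GaloisField p n) ≠ 2 := by
    rw [ringChar.eq (GaloisField p n) p]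
    rintro rfl
    exact absurd hodd (by decide)
  refine Finset.sup_le fun ab _ => ?_
  rcases le_or_gt (p ^ n) 3 with h3 | h3
  · refine (Finite.card_subtype_le _).trans ?_
    rw [GaloisField.card p n hn.ne']
    omega
  · have hfun : (fun x : GaloisField p n => x ^ ((p ^ n - 3) / 2)) = quadInv := by
      funext x
      rw [← hcard]
      exact pow_card_sub_three_div_two hK (hcard ▸ h3) x
    rw [hfun]
    exact deltaCount_quadInv_neg_one_le hK ab.1 ab.2
end

section
/- Let p be a prime and n a positive integer with p^n ≡ 2 (mod 3), and let F : GF(p^n) → GF(p^n) be the power function F(x) = x^d with d = (2·p^n − 1)/3. For every c ∈ GF(p^n) with c ≠ 1, the c-differential uniformity of F is at most 3. -/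
open scoped Classical

theorem pow_mul_three_eq_self {F : Type*} [Field F] [Fintype F] (h : Fintype.card F % 3 = 2)
    (x : F) : x ^ ((2 * Fintype.card F - 1) / 3 * 3) = x := by
  have e : (2 * Fintype.card F - 1) / 3 * 3 = Fintype.card F + (Fintype.card F - 1) := by omega
  rw [e, pow_add, FiniteField.pow_card, ← pow_succ', Nat.sub_add_cancel (by omega),
    FiniteField.pow_card]

/-- If `f` is a right inverse of cubing on a finite field and `c ^ 3 ≠ 1`, each equation
`f (x + a) - c * f x = b` has at most three solutions. -/
theorem deltaCount_le_three {F : Type*} [Field F] [Finite F] {f : F → F}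
    (hf : ∀ x, f x ^ 3 = x) {c : F} (hc : c ^ 3 ≠ 1) (a b : F) :
    deltaCount f c a b ≤ 3 := by
  let P : Cubic F := ⟨c ^ 3 - 1, 3 * c ^ 2 * b, 3 * c * b ^ 2, b ^ 3 - a⟩
  have ha : P.a ≠ 0 := sub_ne_zero.mpr hc
  have hP : P.toPoly ≠ 0 := Cubic.ne_zero_of_a_ne_zero ha
  have hmem : ∀ x, f (x + a) - c * f x = b → f x ∈ P.toPoly.roots.toFinset := by
    intro x hx
    rw [Multiset.mem_toFinset, Polynomial.mem_roots hP]
    simp only [Polynomial.IsRoot, Cubic.toPoly, P, Polynomial.eval_add, Polynomial.eval_mul,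
      Polynomial.eval_C, Polynomial.eval_pow, Polynomial.eval_X]
    have h1 := hf (x + a)
    rw [sub_eq_iff_eq_add.mp hx] at h1
    linear_combination h1 - hf x
  have hcard : P.toPoly.roots.toFinset.card ≤ 3 :=
    (Multiset.toFinset_card_le _).trans
      ((Polynomial.card_roots' _).trans (Cubic.natDegree_of_a_ne_zero ha).le)
  refine le_trans ?_ hcard
  rw [deltaCount, ← Nat.card_eq_finsetCard]
  refine Nat.card_le_card_of_injective
    (fun x => (⟨f x, hmem x x.2⟩ : {y // y ∈ P.toPoly.roots.toFinset})) fun x y hxy => ?_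
  have hf_eq : f x = f y := congrArg Subtype.val hxy
  rw [Subtype.ext_iff, ← hf x, ← hf y, hf_eq]

theorem stmt_18 (p n : ℕ) [Fact p.Prime] (hn : 0 < n) (hmod : p ^ n % 3 = 2)
    (c : GaloisField p n) (hc : c ≠ 1) :
    cDiffUniformity
        (fun x : GaloisField p n => x ^ ((2 * p ^ n - 1) / 3)) c ≤ 3 := by
  have : Fintype (GaloisField p n) := Fintype.ofFinite _
  have hq : Fintype.card (GaloisField p n) = p ^ n := by
    rw [← Nat.card_eq_fintype_card, GaloisField.card p n hn.ne']
  have hpow : ∀ x : GaloisField p n, x ^ ((2 * p ^ n - 1) / 3 * 3) = x := by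
    rw [← hq] at hmod ⊢
    exact pow_mul_three_eq_self hmod
  refine Finset.sup_le fun ab _ => deltaCount_le_three (fun x => ?_) (fun h => hc ?_) _ _
  · rw [← pow_mul, hpow]
  · rw [← hpow c, mul_comm, pow_mul, h, one_pow]
end

section
/- Let n be a positive integer and let η denote the quadratic character on GF(3^n). Then #{ x ∈ GF(3^n) : x ∉ {0, 1, −1} and η(x² − x) = 1 } = #{ x ∈ GF(3^n) : x ∉ {0, 1, −1} and η(x² + x) = 1 } = (3^n − 4 − η(−1))/2. Moreover, if n ≥ 3, there exists α ∈ GF(3^n) with α ∉ {0, 1, −1} such that both α² − α and α² + α are nonzero squares in GF(3^n). -/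
open scoped Classical

/-- The quadratic character `η`: `η(0) = 0`, `η(x) = 1` if `x` is a nonzero square,
and `η(x) = -1` if `x` is a nonsquare. -/
noncomputable def quadChar {F : Type*} [Field F] [Finite F] (x : F) : ℤ :=
  if x = 0 then 0 else if IsSquare x then 1 else -1

theorem quadChar_eq_quadraticChar {F : Type*} [Field F] [Fintype F] (x : F) :
    quadChar x = quadraticChar F x := by
  simp only [quadChar, quadraticChar_apply, quadraticCharFun]
  congr

theorem quadChar_sq_eq_one {F : Type*} [Field F] [Finite F] {x : F} (hx : x ≠ 0) :
    quadChar (x ^ 2) = 1 := by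
  simp [quadChar, hx, IsSquare.sq]

theorem card_filter_quadChar_sq_sub {F : Type*} [Field F] [Fintype F] [CharP F 3] :
    2 * ((Finset.univ.filter fun x : F =>
        x ≠ 0 ∧ x ≠ 1 ∧ x ≠ -1 ∧ quadChar (x ^ 2 - x) = 1).card : ℤ) =
      Fintype.card F - 4 - quadChar (-1 : F) := by
  have h3 : (3 : F) = 0 := CharP.cast_eq_zero F 3
  have hF : ringChar F ≠ 2 := by rw [ringChar.eq F 3]; decide
  have h1 : (1 : F) ≠ -1 := fun h => Ring.neg_one_ne_one_of_char_ne_two hF h.symm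
  have hsum : ∑ x : F, (1 + quadraticChar F (1 - x⁻¹)) = Fintype.card F := by
    have hbij : ∑ x : F, quadraticChar F (1 - x⁻¹) = ∑ x : F, quadraticChar F x :=
      Equiv.sum_comp ((Equiv.inv F).trans (Equiv.subLeft 1)) (quadraticChar F)
    rw [Finset.sum_add_distrib, hbij, quadraticChar_sum_zero hF]
    simp
  have hpt (x : F) : 1 + quadraticChar F (1 - x⁻¹) =
      2 * (if x ≠ 0 ∧ x ≠ 1 ∧ x ≠ -1 ∧ quadChar (x ^ 2 - x) = 1 then 1 else 0) +
      (if x = 0 then 2 else 0) + (if x = 1 then 1 else 0) +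
      (if x = -1 then 1 + quadraticChar F (-1) else 0) := by
    by_cases h0 : x = 0
    · simp [h0]
    by_cases hx1 : x = 1
    · simp [hx1, h1]
    by_cases hx2 : x = -1
    · have h2 : (1 : F) - (-1)⁻¹ = -1 := by
        rw [inv_neg, inv_one]; linear_combination h3
      subst hx2
      rw [h2]
      simp [h1.symm]
    have hfac : x ^ 2 - x = x ^ 2 * (1 - x⁻¹) := by field_simp
    have hne : 1 - x⁻¹ ≠ 0 := by
      rw [sub_ne_zero, ne_comm, Ne, inv_eq_one]; exact hx1
    rw [quadChar_eq_quadraticChar, hfac, map_mul, quadraticChar_sq_one' h0]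
    rcases quadraticChar_dichotomy hne with h | h <;> simp [h0, hx1, hx2, h]
  rw [Finset.sum_congr rfl fun x _ => hpt x] at hsum
  simp only [Finset.sum_add_distrib, ← Finset.mul_sum, Finset.sum_ite_eq', Finset.mem_univ, if_true,
    Finset.sum_boole] at hsum
  rw [quadChar_eq_quadraticChar (-1)]
  linarith

theorem card_filter_quadChar_sq_sub_eq_sq_add {F : Type*} [Field F] [Fintype F] :
    (Finset.univ.filter fun x : F =>
        x ≠ 0 ∧ x ≠ 1 ∧ x ≠ -1 ∧ quadChar (x ^ 2 - x) = 1).card =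
      (Finset.univ.filter fun x : F =>
        x ≠ 0 ∧ x ≠ 1 ∧ x ≠ -1 ∧ quadChar (x ^ 2 + x) = 1).card := by
  refine Finset.card_equiv (Equiv.neg F) fun x => ?_
  simp only [Finset.mem_filter, Finset.mem_univ, true_and, Equiv.neg_apply, neg_sq, neg_inj,
    ← sub_eq_add_neg, neg_eq_iff_eq_neg (b := (1 : F)), Ne, neg_eq_zero]
  tauto

theorem exists_pow_ne_self {F : Type*} [Field F] [Fintype F] {k : ℕ} (hk : 1 < k)
    (hF : k < Fintype.card F) : ∃ m : F, m ^ k ≠ m := by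
  by_contra! h
  refine FiniteField.X_pow_card_sub_X_ne_zero F hk <|
    Polynomial.eq_zero_of_natDegree_lt_card_of_eval_eq_zero _ Function.injective_id
      (fun m => ?_) ?_
  · simp [h m]
  · rwa [FiniteField.X_pow_card_sub_X_natDegree_eq F hk]

theorem exists_quadChar_sq_sub_eq_one_and_sq_add_eq_one {F : Type*} [Field F] [Finite F]
    [CharP F 3] {m : F} (hm : m ^ 9 ≠ m) : ∃ α : F, α ≠ 0 ∧ α ≠ 1 ∧ α ≠ -1 ∧
      quadChar (α ^ 2 - α) = 1 ∧ quadChar (α ^ 2 + α) = 1 := by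
  have h3 : (3 : F) = 0 := CharP.cast_eq_zero F 3
  have hprod : (m - m ^ 3) * (1 + m ^ 2) * (m ^ 2 + m - 1) * (1 + m - m ^ 2) ≠ 0 := by
    contrapose! hm
    grind
  obtain ⟨⟨⟨hd, hs⟩, ha⟩, hb⟩ : ((m - m ^ 3 ≠ 0 ∧ 1 + m ^ 2 ≠ 0) ∧ m ^ 2 + m - 1 ≠ 0) ∧
      1 + m - m ^ 2 ≠ 0 := by
    simpa only [mul_ne_zero_iff] using hprod
  set α := (1 + m ^ 2) ^ 2 / (m - m ^ 3) with hα
  have hα0 : α ≠ 0 := div_ne_zero (pow_ne_zero 2 hs) hd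
  have hsub : α ^ 2 - α = ((1 + m ^ 2) * (1 + m - m ^ 2) / (m - m ^ 3)) ^ 2 := by
    rw [hα]; field_simp; grind
  have hadd : α ^ 2 + α = ((1 + m ^ 2) * (m ^ 2 + m - 1) / (m - m ^ 3)) ^ 2 := by
    rw [hα]; field_simp; grind
  have hsub0 := div_ne_zero (mul_ne_zero hs hb) hd
  have hadd0 := div_ne_zero (mul_ne_zero hs ha) hd
  refine ⟨α, hα0, ?_, ?_, ?_, ?_⟩
  · intro h
    refine pow_ne_zero 2 hsub0 ?_
    rw [← hsub, h]; ring
  · intro h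
    refine pow_ne_zero 2 hadd0 ?_
    rw [← hadd, h]; ring
  · rw [hsub]; exact quadChar_sq_eq_one hsub0
  · rw [hadd]; exact quadChar_sq_eq_one hadd0

theorem stmt_19 (n : ℕ) (hn : 0 < n) :
    letI : Fintype (GaloisField 3 n) := Fintype.ofFinite _
    ((Finset.univ.filter fun x : GaloisField 3 n =>
        x ≠ 0 ∧ x ≠ 1 ∧ x ≠ -1 ∧ quadChar (x ^ 2 - x) = 1).card =
      (Finset.univ.filter fun x : GaloisField 3 n =>
        x ≠ 0 ∧ x ≠ 1 ∧ x ≠ -1 ∧ quadChar (x ^ 2 + x) = 1).card) ∧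
    (((Finset.univ.filter fun x : GaloisField 3 n =>
        x ≠ 0 ∧ x ≠ 1 ∧ x ≠ -1 ∧ quadChar (x ^ 2 - x) = 1).card : ℤ) =
      ((3 : ℤ) ^ n - 4 - quadChar (-1 : GaloisField 3 n)) / 2) ∧
    (3 ≤ n → ∃ α : GaloisField 3 n, α ≠ 0 ∧ α ≠ 1 ∧ α ≠ -1 ∧
      quadChar (α ^ 2 - α) = 1 ∧ quadChar (α ^ 2 + α) = 1) := by
  let _ : Fintype (GaloisField 3 n) := Fintype.ofFinite _
  have hcard : Fintype.card (GaloisField 3 n) = 3 ^ n := by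
    rw [Fintype.card_eq_nat_card, GaloisField.card 3 n hn.ne']
  refine ⟨card_filter_quadChar_sq_sub_eq_sq_add, ?_, fun h => ?_⟩
  · have hcount := card_filter_quadChar_sq_sub (F := GaloisField 3 n)
    rw [hcard] at hcount
    push_cast at hcount
    omega
  · obtain ⟨m, hm⟩ : ∃ m : GaloisField 3 n, m ^ 9 ≠ m := by
      refine exists_pow_ne_self (by norm_num) ?_
      rw [hcard]
      calc 9 < 3 ^ 3 := by norm_num
        _ ≤ 3 ^ n := Nat.pow_le_pow_right (by norm_num) h
    exact exists_quadChar_sq_sub_eq_one_and_sq_add_eq_one hm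
end
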